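/- Let ν ∈ O_K be totally positive. Then ν is a sum of two squares in O_K if and only if v_{𝔭₂}((ν)) + v_{𝔭₂'}((ν)) + Σ_{𝔮 of type q} v_{𝔮}((ν)) is even and v_{𝔯}((ν)) is even for every prime ideal 𝔯 of type r. Moreover, when these conditions hold, r_{2,K}(ν) = 4 · ∏_{𝔭 of type p}(1 + v_{𝔭}((ν))) · ∏_{𝔮 of type q}(1 + v_{𝔮}((ν))). -/

import Mathlib

/-!
Statements about sums of squares in K = ℚ(√17), with ring of integers
O_K = ℤ[ω], ω = (1+√17)/2, realized as ℤ[X]/(X² − X − 4).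
-/

noncomputable section

namespace Paper17

open Polynomial

/-- The ring of integers ℤ[ω] of ℚ(√17), ω = (1+√17)/2, as ℤ[X]/(X² − X − 4). -/
abbrev O17 : Type := AdjoinRoot (X ^ 2 - X - C 4 : ℤ[X])

/-- ω = (1+√17)/2 as an element of O17. -/
def ω : O17 := AdjoinRoot.root _

lemma hroot : (X ^ 2 - X - C 4 : ℤ[X]).eval₂ (Int.castRingHom ℝ)
    ((1 + Real.sqrt 17) / 2) = 0 := by
  have h : Real.sqrt 17 ^ 2 = 17 := Real.sq_sqrt (by norm_num)
  simp only [eval₂_sub, eval₂_pow, eval₂_X, eval₂_C, eval₂_ofNat, map_ofNat]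
  nlinarith [h]

lemma hroot' : (X ^ 2 - X - C 4 : ℤ[X]).eval₂ (Int.castRingHom ℝ)
    ((1 - Real.sqrt 17) / 2) = 0 := by
  have h : Real.sqrt 17 ^ 2 = 17 := Real.sq_sqrt (by norm_num)
  simp only [eval₂_sub, eval₂_pow, eval₂_X, eval₂_C, eval₂_ofNat, map_ofNat]
  nlinarith [h]

/-- The real embedding sending ω to (1+√17)/2. -/
def emb1 : O17 →+* ℝ := AdjoinRoot.lift (Int.castRingHom ℝ) ((1 + Real.sqrt 17) / 2) hroot

/-- The real embedding sending ω to (1−√17)/2. -/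
def emb2 : O17 →+* ℝ := AdjoinRoot.lift (Int.castRingHom ℝ) ((1 - Real.sqrt 17) / 2) hroot'

/-- An element of O_K is totally positive if its images under both real embeddings
are positive. -/
def TotPos (x : O17) : Prop := 0 < emb1 x ∧ 0 < emb2 x

/-- π₂ = (5+√17)/2 = 2 + ω. -/
def pi2 : O17 := 2 + ω

/-- π₂' = (5−√17)/2 = 3 − ω. -/
def pi2' : O17 := 3 - ω

/-- `r2 ν` is the number of pairs (x₁,x₂) ∈ O_K² with x₁² + x₂² = ν. -/
def r2 (ν : O17) : ℕ :=
  Set.ncard {t : O17 × O17 | t.1 ^ 2 + t.2 ^ 2 = ν}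

/-- A nonzero prime ideal of O_K (coprime to 2) is of type p if a totally positive
generator μ satisfies μ ≡ 1 (mod 4). -/
def typeP (P : Ideal O17) : Prop :=
  P.IsPrime ∧ P ≠ ⊥ ∧ ∃ μ : O17, P = Ideal.span {μ} ∧ TotPos μ ∧ (4 : O17) ∣ (μ - 1)

/-- Type q: a totally positive generator μ satisfies μ ≡ 3 (mod 4). -/
def typeQ (P : Ideal O17) : Prop :=
  P.IsPrime ∧ P ≠ ⊥ ∧ ∃ μ : O17, P = Ideal.span {μ} ∧ TotPos μ ∧ (4 : O17) ∣ (μ - 3)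

/-- Type r: a totally positive generator μ satisfies μ ≡ √17 or 2 + √17 (mod 4);
note √17 = 2ω − 1 in O_K. -/
def typeR (P : Ideal O17) : Prop :=
  P.IsPrime ∧ P ≠ ⊥ ∧ ∃ μ : O17, P = Ideal.span {μ} ∧ TotPos μ ∧
    ((4 : O17) ∣ (μ - (2 * ω - 1)) ∨ (4 : O17) ∣ (μ - (2 * ω + 1)))

lemma ω_sq : ω ^ 2 = ω + 4 := by
  have h : AdjoinRoot.mk (X ^ 2 - X - C 4 : ℤ[X]) (X ^ 2 - X - C 4) = 0 := AdjoinRoot.mk_self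
  have h4 : AdjoinRoot.mk (X ^ 2 - X - C 4 : ℤ[X]) (C 4) = 4 := by
    rw [map_ofNat C 4, map_ofNat]
  rw [map_sub, map_sub, map_pow, AdjoinRoot.mk_X, h4] at h
  change ω ^ 2 - ω - 4 = 0 at h
  linear_combination h

/-- Coordinates with respect to the basis `1, ω`. -/
def coord : O17 ≃ₐ[ℤ] QuadraticAlgebra ℤ 4 1 :=
  AlgEquiv.ofAlgHom
    (AdjoinRoot.liftAlgHom _ (Algebra.ofId ℤ _) QuadraticAlgebra.omega (by
      ext <;> simp [pow_two, eval₂_sub, QuadraticAlgebra.re_ofNat,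
        QuadraticAlgebra.im_ofNat]))
    (QuadraticAlgebra.lift ⟨ω, by
      have := ω_sq
      simp only [zsmul_eq_mul]
      push_cast
      linear_combination this⟩)
    (by
      ext <;> simp [ω])
    (by
      ext
      simp [ω])

/-- The coefficient of `1` in the basis `1, ω`. -/
def re (x : O17) : ℤ := (coord x).re

/-- The coefficient of `ω` in the basis `1, ω`. -/
def im (x : O17) : ℤ := (coord x).im

lemma coord_ω : coord ω = QuadraticAlgebra.omega := by
  simp [coord, ω]

@[simp] lemma re_ω : re ω = 0 := by simp [re, coord_ω, QuadraticAlgebra.omega_re]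
@[simp] lemma im_ω : im ω = 1 := by simp [im, coord_ω, QuadraticAlgebra.omega_im]
@[simp] lemma re_add (x y : O17) : re (x + y) = re x + re y := by simp [re]
@[simp] lemma im_add (x y : O17) : im (x + y) = im x + im y := by simp [im]
@[simp] lemma re_sub (x y : O17) : re (x - y) = re x - re y := by simp [re]
@[simp] lemma im_sub (x y : O17) : im (x - y) = im x - im y := by simp [im]
@[simp] lemma re_neg (x : O17) : re (-x) = -re x := by simp [re]
@[simp] lemma im_neg (x : O17) : im (-x) = -im x := by simp [im]
@[simp] lemma re_mul (x y : O17) : re (x * y) = re x * re y + 4 * im x * im y := by simp [re, im]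
@[simp] lemma im_mul (x y : O17) :
    im (x * y) = re x * im y + im x * re y + im x * im y := by simp [re, im]
@[simp] lemma re_zero : re 0 = 0 := by simp [re]
@[simp] lemma im_zero : im 0 = 0 := by simp [im]
@[simp] lemma re_one : re 1 = 1 := by simp [re, QuadraticAlgebra.re_one]
@[simp] lemma im_one : im 1 = 0 := by simp [im, QuadraticAlgebra.im_one]
@[simp] lemma re_intCast (n : ℤ) : re n = n := by simp [re]
@[simp] lemma im_intCast (n : ℤ) : im n = 0 := by simp [im]
@[simp] lemma re_ofNat (n : ℕ) [n.AtLeastTwo] : re (ofNat(n) : O17) = ofNat(n) := by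
  rw [← Int.cast_ofNat, re_intCast]
@[simp] lemma im_ofNat (n : ℕ) [n.AtLeastTwo] : im (ofNat(n) : O17) = 0 := by
  rw [← Int.cast_ofNat, im_intCast]

lemma ext_coord {x y : O17} (h₁ : re x = re y) (h₂ : im x = im y) : x = y :=
  coord.injective (QuadraticAlgebra.ext h₁ h₂)

lemma eq_re_add_im (x : O17) : x = (re x : O17) + (im x : O17) * ω :=
  ext_coord (by simp) (by simp)

/-- The norm from `O17` to `ℤ`. -/
def nrm : O17 →* ℤ := QuadraticAlgebra.norm.comp (coord : O17 →* QuadraticAlgebra ℤ 4 1)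

lemma nrm_eq (x : O17) : nrm x = re x ^ 2 + re x * im x - 4 * im x ^ 2 := by
  simp [nrm, QuadraticAlgebra.norm_def, re, im]
  ring

lemma emb1_eq (x : O17) : emb1 x = re x + im x * ((1 + Real.sqrt 17) / 2) := by
  conv_lhs => rw [eq_re_add_im x]
  simp [emb1, ω]

lemma emb2_eq (x : O17) : emb2 x = re x + im x * ((1 - Real.sqrt 17) / 2) := by
  conv_lhs => rw [eq_re_add_im x]
  simp [emb2, ω]

lemma sqrt17_sq : Real.sqrt 17 ^ 2 = 17 := Real.sq_sqrt (by norm_num)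

lemma emb_mul_emb (x : O17) : emb1 x * emb2 x = nrm x := by
  rw [emb1_eq, emb2_eq, nrm_eq]
  push_cast
  linear_combination (-(im x : ℝ) ^ 2 / 4) * sqrt17_sq

lemma emb_add_emb (x : O17) : emb1 x + emb2 x = 2 * re x + im x := by
  rw [emb1_eq, emb2_eq]
  ring

lemma totPos_iff (x : O17) : TotPos x ↔ 0 < nrm x ∧ 0 < 2 * re x + im x := by
  have h₁ := emb_mul_emb x
  have h₂ := emb_add_emb x
  have e₁ : 0 < nrm x ↔ (0 : ℝ) < nrm x := by norm_cast
  have e₂ : 0 < 2 * re x + im x ↔ (0 : ℝ) < 2 * re x + im x := by norm_cast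
  rw [e₁, e₂, ← h₁, ← h₂, TotPos]
  constructor
  · rintro ⟨ha, hb⟩
    exact ⟨mul_pos ha hb, add_pos ha hb⟩
  · rintro ⟨ha, hb⟩
    rcases pos_and_pos_or_neg_and_neg_of_mul_pos ha with h | h
    · exact h
    · linarith [h.1, h.2]

lemma nrm_eq_zero {x : O17} (h : nrm x = 0) : x = 0 := by
  rw [nrm_eq] at h
  have h' : (2 * re x + im x) ^ 2 = 17 * im x ^ 2 := by linear_combination 4 * h
  have him : im x = 0 := by
    by_contra hne
    have hirr : Irrational (Real.sqrt 17) := by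
      simpa using (show Nat.Prime 17 by norm_num).irrational_sqrt
    apply hirr
    refine ⟨|((2 * re x + im x : ℤ) : ℚ) / (im x : ℚ)|, ?_⟩
    rw [eq_comm, Real.sqrt_eq_iff_mul_self_eq (by norm_num) (by positivity)]
    have hr : ((im x : ℤ) : ℝ) ≠ 0 := by exact_mod_cast hne
    push_cast
    rw [abs_mul_abs_self]
    field_simp
    have hc : (17 : ℝ) * im x ^ 2 = (2 * re x + im x) ^ 2 := by exact_mod_cast h'.symm
    simpa using hc
  have hre : re x = 0 := by
    rw [him] at h'
    have : (2 * re x) ^ 2 = 0 := by linear_combination h'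
    have := pow_eq_zero_iff (two_ne_zero) |>.1 this
    omega
  exact ext_coord (by simpa using hre) (by simpa using him)

lemma emb1_injective : Function.Injective emb1 := by
  rw [injective_iff_map_eq_zero]
  intro x hx
  apply nrm_eq_zero
  have := emb_mul_emb x
  rw [hx, zero_mul] at this
  exact_mod_cast this.symm

lemma emb2_injective : Function.Injective emb2 := by
  rw [injective_iff_map_eq_zero]
  intro x hx
  apply nrm_eq_zero
  have := emb_mul_emb x
  rw [hx, mul_zero] at this
  exact_mod_cast this.symm

instance : IsDomain O17 := emb1_injective.isDomain

/-- Galois conjugation. -/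
def conj (x : O17) : O17 := ((re x + im x : ℤ) : O17) - (im x : O17) * ω

lemma mul_conj (x : O17) : x * conj x = (nrm x : O17) := by
  conv_lhs => rw [eq_re_add_im x]
  rw [conj, nrm_eq]
  simp
  linear_combination -((im x : O17) ^ 2) * ω_sq

lemma isUnit_iff_nrm (x : O17) : IsUnit x ↔ IsUnit (nrm x) := by
  refine ⟨fun h => h.map nrm, fun h => ?_⟩
  apply isUnit_of_mul_isUnit_left (y := conj x)
  rw [mul_conj]
  exact h.map (Int.castRingHom O17)

lemma exists_small_remainder (x y : O17) (hy : y ≠ 0) :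
    ∃ q : O17, |nrm (x - q * y)| < |nrm y| := by
  set n : ℤ := nrm y with hn
  have hn0 : n ≠ 0 := fun h => hy (nrm_eq_zero h)
  set z := x * conj y with hz
  have key : ∀ q : O17, nrm (x - q * y) * n = nrm (z - q * n) := by
    intro q
    have h1 : z - q * n = (x - q * y) * conj y := by
      rw [sub_mul, mul_assoc, mul_conj]
    have h2 : nrm (conj y) = n := by
      have := congrArg nrm (mul_conj y)
      rw [map_mul] at this
      apply mul_left_cancel₀ hn0
      rw [this, ← hn, nrm_eq (n : O17)]
      simp
      ring
    rw [h1, map_mul, h2]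
  have hnR : (n : ℝ) ≠ 0 := by exact_mod_cast hn0
  set B : ℝ := im z / n
  set A : ℝ := re z / n
  set b : ℤ := round B
  set v : ℝ := B - b
  have hv : |v| ≤ 1 / 2 := abs_sub_round B
  set u₀ : ℝ := A + v / 2
  obtain ⟨a, ha⟩ : ∃ a : ℤ, |(u₀ - a) ^ 2 - 17 / 4 * v ^ 2| < 1 := by
    have hv2 : v ^ 2 ≤ 1 / 4 := by
      have := abs_le.1 hv
      nlinarith
    have hv0 : 0 ≤ v ^ 2 := sq_nonneg v
    have hu := abs_le.1 (abs_sub_round u₀)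
    by_cases hD : 17 / 4 * v ^ 2 < 1
    · refine ⟨round u₀, abs_lt.2 ⟨?_, ?_⟩⟩ <;> nlinarith
    · by_cases hs : 0 ≤ u₀ - round u₀
      · refine ⟨round u₀ + 1, abs_lt.2 ⟨?_, ?_⟩⟩ <;> push_cast <;> nlinarith
      · refine ⟨round u₀ - 1, abs_lt.2 ⟨?_, ?_⟩⟩ <;> push_cast <;> nlinarith
  refine ⟨(a : O17) + b * ω, ?_⟩
  have k := key ((a : O17) + b * ω)
  rw [nrm_eq (z - _)] at k
  simp at k
  have hA : (re z : ℝ) = A * n := by simp only [A]; field_simp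
  have hB : (im z : ℝ) = B * n := by simp only [B]; field_simp
  have k' : (nrm (x - ((a : O17) + b * ω) * y) : ℝ) = n * ((u₀ - a) ^ 2 - 17 / 4 * v ^ 2) := by
    apply mul_right_cancel₀ hnR
    have := congrArg (fun t : ℤ => (t : ℝ)) k
    push_cast at this
    rw [this, hA, hB]
    simp only [u₀, v]
    ring
  have : |(nrm (x - ((a : O17) + b * ω) * y) : ℝ)| < |(n : ℝ)| := by
    rw [k', abs_mul]
    exact mul_lt_of_lt_one_right (abs_pos.2 hnR) ha
  exact_mod_cast this

instance : IsPrincipalIdealRing O17 where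
  principal I := by
    by_cases hI : I = ⊥
    · exact hI ▸ bot_isPrincipal
    obtain ⟨x₀, hx₀, hx₀'⟩ := Submodule.exists_mem_ne_zero_of_ne_bot hI
    obtain ⟨g, ⟨hg, hg0⟩, hmin⟩ := exists_minimalFor_of_wellFoundedLT
      (fun x : O17 => x ∈ I ∧ x ≠ 0) (fun x => (nrm x).natAbs) ⟨x₀, hx₀, hx₀'⟩
    refine ⟨g, le_antisymm (fun x hx => ?_) ?_⟩
    · obtain ⟨q, hq⟩ := exists_small_remainder x g hg0
      have hmem : x - q * g ∈ I := I.sub_mem hx (I.mul_mem_left q hg)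
      have h0 : x - q * g = 0 := by
        by_contra hne
        have := hmin (j := x - q * g) ⟨hmem, hne⟩
        simp only at this
        rw [Int.abs_eq_natAbs, Int.abs_eq_natAbs] at hq
        omega
      rw [sub_eq_zero.1 h0]
      exact Ideal.mem_span_singleton.2 (dvd_mul_left g q)
    · exact (Ideal.span_singleton_le_iff_mem I).2 hg

instance : Module.Free ℤ O17 := Module.Free.of_equiv coord.symm.toLinearEquiv

instance : Module.Finite ℤ O17 := Module.Finite.equiv coord.symm.toLinearEquiv

lemma algebra_norm_eq (x : O17) : @Algebra.norm ℤ O17 _ _ (Ring.toIntAlgebra O17) x = nrm x := by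
  rw [Subsingleton.elim (Ring.toIntAlgebra O17) (AdjoinRoot.instAlgebra _)]
  rw [← Algebra.norm_eq_of_algEquiv coord, Algebra.norm_apply]
  exact QuadraticAlgebra.det_toLinearMap_eq_norm _

lemma card_quotient (μ : O17) : Nat.card (O17 ⧸ Ideal.span {μ}) = (nrm μ).natAbs := by
  have := Ideal.absNorm_span_singleton μ
  rw [algebra_norm_eq] at this
  rw [← this, Ideal.absNorm_apply, Submodule.cardQuot_apply]

lemma exists_dvd_sq_add_one_iff {μ : O17} (hμ : Prime μ) :
    (∃ t : O17, μ ∣ t ^ 2 + 1) ↔ (nrm μ).natAbs % 4 ≠ 3 := by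
  have hne : Ideal.span {μ} ≠ ⊥ := by simpa using hμ.ne_zero
  have hP : (Ideal.span {μ}).IsPrime := (Ideal.span_singleton_prime hμ.ne_zero).2 hμ
  have hM : (Ideal.span {μ}).IsMaximal := hP.isMaximal hne
  let _ : Field (O17 ⧸ Ideal.span {μ}) := Ideal.Quotient.field _
  have : Finite (O17 ⧸ Ideal.span {μ}) := Ideal.finiteQuotientOfFreeOfNeBot _ hne
  let _ : Fintype (O17 ⧸ Ideal.span {μ}) := Fintype.ofFinite _
  rw [← card_quotient, Nat.card_eq_fintype_card, ← FiniteField.isSquare_neg_one_iff]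
  have key : ∀ t : O17, μ ∣ t ^ 2 + 1 ↔
      (-1 : O17 ⧸ Ideal.span {μ}) = Ideal.Quotient.mk _ t * Ideal.Quotient.mk _ t := by
    intro t
    rw [← Ideal.mem_span_singleton, ← Ideal.Quotient.eq_zero_iff_mem, map_add, map_pow, map_one,
      ← pow_two, eq_comm (a := (-1 : O17 ⧸ Ideal.span {μ})), eq_neg_iff_add_eq_zero]
  constructor
  · rintro ⟨t, ht⟩
    exact ⟨_, (key t).1 ht⟩
  · rintro ⟨s, hs⟩
    obtain ⟨t, rfl⟩ := Ideal.Quotient.mk_surjective s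
    exact ⟨t, (key t).2 hs⟩

/-- The element `x + y√17` attached to a solution of Pell's equation. -/
def pellHom : Pell.Solution₁ 17 →* O17 where
  toFun a := (a.x : O17) + a.y * (2 * ω - 1)
  map_one' := by simp
  map_mul' a b := by
    rw [Pell.Solution₁.x_mul, Pell.Solution₁.y_mul]
    push_cast
    linear_combination (-4 * (a.y : O17) * b.y) * ω_sq

lemma pell_fundamental :
    Pell.IsFundamental (Pell.Solution₁.mk 33 8 (by norm_num) : Pell.Solution₁ 17) := by
  refine ⟨by simp, by simp, fun {b} hb => ?_⟩
  by_contra hlt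
  simp only [Pell.Solution₁.x_mk, not_le] at hlt
  have hp := b.prop
  have hy : b.y ^ 2 < 64 := by nlinarith
  have hy1 : b.y < 8 := by nlinarith
  have hy2 : -8 < b.y := by nlinarith
  generalize b.x = x at *
  generalize b.y = y at *
  interval_cases y <;> interval_cases x <;> omega

lemma TotPos.mul {x y : O17} (hx : TotPos x) (hy : TotPos y) : TotPos (x * y) :=
  ⟨by rw [map_mul]; exact mul_pos hx.1 hy.1, by rw [map_mul]; exact mul_pos hx.2 hy.2⟩

lemma TotPos.of_mul_left {x y : O17} (hx : TotPos x) (hxy : TotPos (x * y)) : TotPos y := by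
  rw [TotPos, map_mul, map_mul] at hxy
  exact ⟨(mul_pos_iff_of_pos_left hx.1).1 hxy.1, (mul_pos_iff_of_pos_left hx.2).1 hxy.2⟩

lemma TotPos.pow {x : O17} (hx : TotPos x) (n : ℕ) : TotPos (x ^ n) :=
  ⟨by rw [map_pow]; exact pow_pos hx.1 n, by rw [map_pow]; exact pow_pos hx.2 n⟩

lemma TotPos.ne_zero {x : O17} (hx : TotPos x) : x ≠ 0 := by
  rintro rfl
  simpa using hx.1

lemma totPos_sq {x : O17} (hx : x ≠ 0) : TotPos (x ^ 2) := by
  refine ⟨?_, ?_⟩ <;> rw [map_pow]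
  · exact sq_pos_of_ne_zero ((map_ne_zero_iff _ emb1_injective).2 hx)
  · exact sq_pos_of_ne_zero ((map_ne_zero_iff _ emb2_injective).2 hx)

lemma TotPos.nrm_pos {x : O17} (hx : TotPos x) : 0 < nrm x := ((totPos_iff x).1 hx).1

lemma even_im_of_odd_nrm {x : O17} (h : Odd (nrm x)) : Even (im x) := by
  rw [nrm_eq] at h
  by_contra hi
  rw [Int.not_even_iff_odd] at hi
  rcases Int.even_or_odd (re x) with hr | hr <;> revert h <;>
    simp [Int.even_add, Int.even_sub, Int.even_mul, Int.even_pow, ← Int.not_even_iff_odd] at * <;>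
    tauto

lemma exists_sq_of_totPos_unit {u : O17} (hu : IsUnit u) (hpos : TotPos u) :
    ∃ w : O17, IsUnit w ∧ u = w ^ 2 := by
  have h1 : nrm u = 1 := by
    have := Int.isUnit_iff.1 ((isUnit_iff_nrm u).1 hu)
    have := hpos.nrm_pos
    omega
  obtain ⟨c, hc⟩ := even_im_of_odd_nrm (x := u) (by rw [h1]; exact odd_one)
  rw [nrm_eq, hc] at h1
  let s : Pell.Solution₁ 17 := Pell.Solution₁.mk (re u + c) c (by linear_combination h1)
  have hs : pellHom s = u := by
    conv_rhs => rw [eq_re_add_im u, hc]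
    simp [pellHom, s]
    ring
  have hε : pellHom (Pell.Solution₁.mk 33 8 (by norm_num)) = (3 + 2 * ω) ^ 2 := by
    simp [pellHom]
    linear_combination -4 * ω_sq
  have hεu : IsUnit (3 + 2 * ω : O17) := by
    rw [isUnit_iff_nrm, nrm_eq]
    simp
  obtain ⟨e, he⟩ := hεu
  have hE : pellHom.toHomUnits (Pell.Solution₁.mk 33 8 (by norm_num)) = e ^ 2 := by
    ext
    rw [MonoidHom.coe_toHomUnits, hε, Units.val_pow_eq_pow_val, he]
  obtain ⟨n, hn | hn⟩ := pell_fundamental.eq_zpow_or_neg_zpow s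
  · refine ⟨((e ^ n : O17ˣ) : O17), Units.isUnit _, ?_⟩
    rw [← hs, hn, ← MonoidHom.coe_toHomUnits, map_zpow, hE, ← Units.val_pow_eq_pow_val,
      ← zpow_natCast, ← zpow_natCast, zpow_comm]
  · exfalso
    have h2 : u = -((e ^ n : O17ˣ) : O17) ^ 2 := by
      have : pellHom (-(Pell.Solution₁.mk 33 8 (by norm_num) : Pell.Solution₁ 17) ^ n) =
          - pellHom ((Pell.Solution₁.mk 33 8 (by norm_num) : Pell.Solution₁ 17) ^ n) := by
        simp [pellHom]
        ring
      rw [← hs, hn, this, ← MonoidHom.coe_toHomUnits, map_zpow, hE, ← Units.val_pow_eq_pow_val,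
        ← zpow_natCast, ← zpow_natCast, zpow_comm]
    have := hpos.1
    rw [h2, map_neg, map_pow] at this
    nlinarith [sq_nonneg (emb1 ((e ^ n : O17ˣ) : O17))]

lemma exists_totPos_associate {x : O17} (hx : x ≠ 0) : ∃ u : O17, IsUnit u ∧ TotPos (u * x) := by
  have hε : nrm (3 + 2 * ω) = -1 := by
    rw [nrm_eq]
    simp
  have hεu : IsUnit (3 + 2 * ω : O17) := by
    rw [isUnit_iff_nrm, hε]
    simp
  have pos : ∀ y : O17, 0 < nrm y → ∃ u : O17, IsUnit u ∧ TotPos (u * y) := by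
    intro y hy
    by_cases ht : 0 < 2 * re y + im y
    · exact ⟨1, isUnit_one, by rw [one_mul]; exact (totPos_iff y).2 ⟨hy, ht⟩⟩
    · refine ⟨-1, isUnit_one.neg, (totPos_iff _).2 ?_⟩
      rw [nrm_eq] at hy ⊢
      simp
      refine ⟨by linarith, ?_⟩
      rcases lt_or_eq_of_le (not_lt.1 ht) with h | h
      · linarith
      · nlinarith [sq_nonneg (im y)]
  rcases lt_trichotomy (nrm x) 0 with h | h | h
  · obtain ⟨u, hu, hp⟩ := pos ((3 + 2 * ω) * x) (by rw [map_mul, hε]; linarith)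
    exact ⟨u * (3 + 2 * ω), hu.mul hεu, by rwa [mul_assoc]⟩
  · exact absurd (nrm_eq_zero h) hx
  · exact pos x h

/-- The set of representations of `ν` as a sum of two squares. -/
def reps (ν : O17) : Set (O17 × O17) := {t | t.1 ^ 2 + t.2 ^ 2 = ν}

lemma reps_finite (ν : O17) : (reps ν).Finite := by
  obtain ⟨B, hB⟩ : ∃ B : ℤ, B = 2 * re ν + im ν := ⟨_, rfl⟩
  let c : O17 × O17 → (ℤ × ℤ) × (ℤ × ℤ) := fun t => ((re t.1, im t.1), (re t.2, im t.2))
  have hc : Function.Injective c := by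
    rintro ⟨x, y⟩ ⟨x', y'⟩ h
    simp only [c, Prod.mk.injEq] at h
    exact Prod.ext (ext_coord h.1.1 h.1.2) (ext_coord h.2.1 h.2.2)
  refine Set.Finite.subset (Set.Finite.preimage hc.injOn
    (Set.finite_Icc (((-B, -B), (-B, -B)) : (ℤ × ℤ) × (ℤ × ℤ)) ((B, B), (B, B)))) ?_
  rintro ⟨x, y⟩ h
  have h1 := congrArg re (show x ^ 2 + y ^ 2 = ν from h)
  have h2 := congrArg im (show x ^ 2 + y ^ 2 = ν from h)
  simp [pow_two] at h1 h2
  have aux : ∀ n : ℤ, n ^ 2 ≤ B → -B ≤ n ∧ n ≤ B := fun n hn =>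
    ⟨by nlinarith, by nlinarith⟩
  have k : (re x ^ 2 + im x ^ 2) + (re y ^ 2 + im y ^ 2) ≤ B := by
    nlinarith [sq_nonneg (re x + im x), sq_nonneg (re y + im y), sq_nonneg (im x),
      sq_nonneg (im y)]
  have b1 := aux (re x) (by nlinarith [sq_nonneg (im x), sq_nonneg (im y), sq_nonneg (re y)])
  have b2 := aux (im x) (by nlinarith [sq_nonneg (re x), sq_nonneg (im y), sq_nonneg (re y)])
  have b3 := aux (re y) (by nlinarith [sq_nonneg (im x), sq_nonneg (im y), sq_nonneg (re x)])
  have b4 := aux (im y) (by nlinarith [sq_nonneg (im x), sq_nonneg (re x), sq_nonneg (re y)])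
  exact ⟨⟨⟨b1.1, b2.1⟩, ⟨b3.1, b4.1⟩⟩, ⟨⟨b1.2, b2.2⟩, ⟨b3.2, b4.2⟩⟩⟩

open MeasureTheory in
lemma volume_four_ball :
    volume {x : Fin 4 → ℝ | ∑ j, x j ^ 2 < 8} = ENNReal.ofReal (32 * Real.pi ^ 2) := by
  have h := volume_sum_rpow_lt (Fin 4) (p := 2) (by norm_num) (Real.sqrt 8)
  have hset : {x : Fin 4 → ℝ | (∑ i, |x i| ^ (2 : ℝ)) ^ (1 / 2 : ℝ) < Real.sqrt 8} =
      {x : Fin 4 → ℝ | ∑ j, x j ^ 2 < 8} := by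
    ext x
    simp only [Set.mem_ofPred_eq, Real.rpow_two, sq_abs]
    rw [← Real.sqrt_eq_rpow, Real.sqrt_lt_sqrt_iff (by positivity)]
  rw [hset] at h
  rw [h, Real.Gamma_add_one (by norm_num), Real.Gamma_one_half_eq]
  have h3 : Real.Gamma (((Fintype.card (Fin 4) : ℕ) : ℝ) / 2 + 1) = 2 := by
    have := Real.Gamma_nat_eq_factorial 2
    norm_num at this ⊢
  rw [h3, ← ENNReal.ofReal_pow (by positivity), ← ENNReal.ofReal_mul (by positivity)]
  congr 1
  simp only [Fintype.card_fin]
  have h8 : Real.sqrt 8 ^ 4 = 64 := by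
    rw [show Real.sqrt 8 ^ 4 = (Real.sqrt 8 ^ 2) ^ 2 by ring, Real.sq_sqrt (by norm_num)]
    norm_num
  have hpi : Real.sqrt Real.pi ^ 4 = Real.pi ^ 2 := by
    rw [show Real.sqrt Real.pi ^ 4 = (Real.sqrt Real.pi ^ 2) ^ 2 by ring,
      Real.sq_sqrt Real.pi_pos.le]
  rw [h8]
  ring_nf
  rw [hpi]

open MeasureTheory in
lemma exists_short_vector (M : Matrix (Fin 4) (Fin 4) ℝ) (hM : |M.det| = 17) :
    ∃ c : Fin 4 → ℤ, c ≠ 0 ∧ ∑ j, (∑ i, (c i : ℝ) * M i j) ^ 2 < 8 := by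
  have hdet : M.det ≠ 0 := by
    intro h
    rw [h] at hM
    norm_num at hM
  have hcard : Fintype.card (Fin 4) = Module.finrank ℝ (Fin 4 → ℝ) := by simp
  have hli := Matrix.linearIndependent_rows_of_det_ne_zero hdet
  set b := basisOfLinearIndependentOfCardEqFinrank hli hcard with hb
  have hbM : ∀ i, b i = M i := fun i => by
    rw [hb, coe_basisOfLinearIndependentOfCardEqFinrank]
  have hvol := ZSpan.volume_fundamentalDomain b
  have hof : Matrix.of ⇑b = M := by
    ext i j
    simp [hbM]
  rw [hof, hM] at hvol
  have hfund : IsAddFundamentalDomain (Submodule.span ℤ (Set.range b)).toAddSubgroup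
    (ZSpan.fundamentalDomain b) volume := ZSpan.isAddFundamentalDomain b volume
  have hcount : Countable (Submodule.span ℤ (Set.range b)).toAddSubgroup :=
    inferInstanceAs (Countable (Submodule.span ℤ (Set.range b)))
  obtain ⟨v, hv0, hv⟩ := exists_ne_zero_mem_lattice_of_measure_mul_two_pow_lt_measure hfund
    (s := {x : Fin 4 → ℝ | ∑ j, x j ^ 2 < 8}) (by simp)
    (by
      intro x hx y hy p q hp hq hpq
      simp only [Set.mem_ofPred_eq, Fin.sum_univ_four, Pi.add_apply, Pi.smul_apply,
        smul_eq_mul] at *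
      have aux : ∀ s t : ℝ, (p * s + q * t) ^ 2 ≤ p * s ^ 2 + q * t ^ 2 := by
        intro s t
        have hq' : q = 1 - p := by linarith
        have : p * s ^ 2 + q * t ^ 2 - (p * s + q * t) ^ 2 = p * q * (s - t) ^ 2 := by
          rw [hq']
          ring
        nlinarith [mul_nonneg (mul_nonneg hp hq) (sq_nonneg (s - t))]
      have h0 := aux (x 0) (y 0)
      have h1 := aux (x 1) (y 1)
      have h2 := aux (x 2) (y 2)
      have h3 := aux (x 3) (y 3)
      rcases hp.lt_or_eq with hp' | hp'
      · have := mul_lt_mul_of_pos_left hx hp'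
        have := mul_le_mul_of_nonneg_left hy.le hq
        have : p * 8 + q * 8 = 8 := by rw [← add_mul, hpq, one_mul]
        linarith
      · have hq1 : q = 1 := by linarith
        rw [← hp', hq1] at *
        linarith)
    (by
      rw [hvol, volume_four_ball]
      simp only [Module.finrank_fintype_fun_eq_card, Fintype.card_fin]
      rw [show ((2 : ENNReal) ^ 4) = ENNReal.ofReal 16 by norm_num,
        ← ENNReal.ofReal_mul (by norm_num), ENNReal.ofReal_lt_ofReal_iff (by positivity)]
      nlinarith [Real.pi_gt_three])
  obtain ⟨c, hc⟩ := (Submodule.mem_span_range_iff_exists_fun ℤ).1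
    (show (v : Fin 4 → ℝ) ∈ Submodule.span ℤ (Set.range b) from v.2)
  refine ⟨c, ?_, ?_⟩
  · rintro rfl
    apply hv0
    ext1
    simp [← hc]
  · have hvj : ∀ j, (v : Fin 4 → ℝ) j = ∑ i, (c i : ℝ) * M i j := by
      intro j
      rw [← hc]
      simp [hbM]
    simpa only [Set.mem_ofPred_eq, hvj] using hv

lemma small_trace_cases {c : O17} (hc : TotPos c) (hk : 2 * re c + im c < 8) :
    c = 1 ∨ c = 2 ∨ c = 3 ∨ c = 2 + ω ∨ c = 3 - ω ∨ c = 3 + ω ∨ c = 4 - ω := by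
  obtain ⟨hn, htr⟩ := (totPos_iff c).1 hc
  rw [nrm_eq] at hn
  have him : im c ^ 2 < 4 := by nlinarith
  have hi1 : im c < 2 := by nlinarith
  have hi2 : -2 < im c := by nlinarith
  have key : ∀ d : O17, re c = re d → im c = im d → c = d := fun d => ext_coord
  have h1 := key 1
  have h2 := key 2
  have h3 := key 3
  have h4 := key (2 + ω)
  have h5 := key (3 - ω)
  have h6 := key (3 + ω)
  have h7 := key (4 - ω)
  simp only [re_one, im_one, re_add, im_add, re_sub, im_sub, re_ofNat, im_ofNat, re_ω, im_ω]
    at h1 h2 h3 h4 h5 h6 h7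
  have hr1 : re c < 5 := by omega
  have hr2 : -1 < re c := by omega
  revert hn htr hk h1 h2 h3 h4 h5 h6 h7
  generalize im c = i at *
  generalize re c = r at *
  interval_cases i <;> interval_cases r <;> intro hk hn htr h1 h2 h3 h4 h5 h6 h7 <;>
    first
    | omega
    | (exfalso; revert hn; norm_num; done)
    | exact .inl (h1 rfl rfl)
    | exact .inr (.inl (h2 rfl rfl))
    | exact .inr (.inr (.inl (h3 rfl rfl)))
    | exact .inr (.inr (.inr (.inl (h4 rfl rfl))))
    | exact .inr (.inr (.inr (.inr (.inl (h5 rfl rfl)))))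
    | exact .inr (.inr (.inr (.inr (.inr (.inl (h6 rfl rfl))))))
    | exact .inr (.inr (.inr (.inr (.inr (.inr (h7 rfl rfl))))))

/-- Rows are the two real embeddings of a basis of the lattice `{(x, y) | y ≡ t x mod μ}`. -/
lemma det_lattice (t₁ t₂ r₁ r₂ m₁ m₂ : ℝ) (h₁ : 0 < r₁) (h₂ : 0 < r₂)
    (e₁ : r₁ ^ 2 = m₁) (e₂ : r₂ ^ 2 = m₂) :
    |(Matrix.of ![![1 / r₁, t₁ / r₁, 1 / r₂, t₂ / r₂],
      ![(1 + Real.sqrt 17) / 2 / r₁, t₁ * ((1 + Real.sqrt 17) / 2) / r₁,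
        (1 - Real.sqrt 17) / 2 / r₂, t₂ * ((1 - Real.sqrt 17) / 2) / r₂],
      ![0 / r₁, m₁ / r₁, 0 / r₂, m₂ / r₂],
      ![0 / r₁, m₁ * ((1 + Real.sqrt 17) / 2) / r₁,
        0 / r₂, m₂ * ((1 - Real.sqrt 17) / 2) / r₂]]).det| = 17 := by
  have : ∀ M : Matrix (Fin 4) (Fin 4) ℝ, M.det = -17 → |M.det| = 17 := by
    intro M h
    rw [h]
    norm_num
  apply this
  rw [Matrix.det_succ_row_zero]
  simp [Fin.sum_univ_succ, Matrix.det_fin_three, ← e₁, ← e₂, Fin.succAbove]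
  field_simp
  linear_combination (-4) * sqrt17_sq

lemma exists_small_multiple {μ t : O17} (hμ : TotPos μ) (ht : μ ∣ t ^ 2 + 1) :
    ∃ x y c : O17, x ^ 2 + y ^ 2 = c * μ ∧
      (c = 1 ∨ c = 2 ∨ c = 3 ∨ c = 2 + ω ∨ c = 3 - ω ∨ c = 3 + ω ∨ c = 4 - ω) := by
  obtain ⟨r₁, hr₁, hr₁'⟩ : ∃ r : ℝ, 0 < r ∧ r ^ 2 = emb1 μ :=
    ⟨_, Real.sqrt_pos.2 hμ.1, Real.sq_sqrt hμ.1.le⟩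
  obtain ⟨r₂, hr₂, hr₂'⟩ : ∃ r : ℝ, 0 < r ∧ r ^ 2 = emb2 μ :=
    ⟨_, Real.sqrt_pos.2 hμ.2, Real.sq_sqrt hμ.2.le⟩
  have ω₁ : emb1 ω = (1 + Real.sqrt 17) / 2 := by simp [emb1_eq]
  have ω₂ : emb2 ω = (1 - Real.sqrt 17) / 2 := by simp [emb2_eq]
  obtain ⟨k, hk0, hk⟩ := exists_short_vector _
    (det_lattice (emb1 t) (emb2 t) r₁ r₂ (emb1 μ) (emb2 μ) hr₁ hr₂ hr₁' hr₂')
  set x : O17 := (k 0 : O17) + k 1 * ω with hx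
  set y : O17 := t * x + μ * ((k 2 : O17) + k 3 * ω) with hy
  have hdvd : μ ∣ x ^ 2 + y ^ 2 := by
    obtain ⟨w, hw⟩ := ht
    refine ⟨x ^ 2 * w + 2 * t * x * (k 2 + k 3 * ω) + μ * (k 2 + k 3 * ω) ^ 2, ?_⟩
    rw [hy]
    linear_combination x ^ 2 * hw
  obtain ⟨c, hc⟩ := hdvd
  have e1 : emb1 c = (emb1 x ^ 2 + emb1 y ^ 2) / emb1 μ := by
    rw [eq_div_iff hμ.1.ne', ← map_pow, ← map_pow, ← map_add, hc, map_mul, mul_comm]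
  have e2 : emb2 c = (emb2 x ^ 2 + emb2 y ^ 2) / emb2 μ := by
    rw [eq_div_iff hμ.2.ne', ← map_pow, ← map_pow, ← map_add, hc, map_mul, mul_comm]
  have hsum : emb1 c + emb2 c < 8 := by
    refine lt_of_eq_of_lt ?_ hk
    rw [e1, e2, hy, hx]
    simp only [Fin.sum_univ_four, map_add, map_mul, map_intCast, ω₁, ω₂, Matrix.of_apply,
      Matrix.cons_val, ← hr₁', ← hr₂']
    field_simp
    ring
  have hxy : x ≠ 0 ∨ y ≠ 0 := by
    by_contra hcon
    push Not at hcon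
    have coeff : ∀ m n : ℤ, (m : O17) + n * ω = 0 → m = 0 ∧ n = 0 := by
      intro m n h
      have h1 := congrArg re h
      have h2 := congrArg im h
      simp at h1 h2
      exact ⟨h1, h2⟩
    obtain ⟨h0, h1⟩ := coeff _ _ hcon.1
    have hy' := hcon.2
    rw [hy, hcon.1, mul_zero, zero_add, mul_eq_zero, or_iff_right hμ.ne_zero] at hy'
    obtain ⟨h2, h3⟩ := coeff _ _ hy'
    apply hk0
    ext i
    fin_cases i <;> assumption
  have hcpos : TotPos c := by
    apply TotPos.of_mul_left hμ
    rw [← hc]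
    constructor
    · rw [map_add, map_pow, map_pow]
      rcases hxy with h | h
      · have := (totPos_sq h).1
        rw [map_pow] at this
        positivity
      · have := (totPos_sq h).1
        rw [map_pow] at this
        positivity
    · rw [map_add, map_pow, map_pow]
      rcases hxy with h | h
      · have := (totPos_sq h).2
        rw [map_pow] at this
        positivity
      · have := (totPos_sq h).2
        rw [map_pow] at this
        positivity
  rw [emb_add_emb] at hsum
  have hk' : 2 * re c + im c < 8 := by exact_mod_cast hsum
  exact ⟨x, y, c, by rw [hc, mul_comm], small_trace_cases hcpos hk'⟩

lemma pi2_mul_pi2' : pi2 * pi2' = 2 := by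
  unfold pi2 pi2'
  linear_combination -ω_sq

lemma re_pi2 : re pi2 = 2 := by simp [pi2]

lemma im_pi2 : im pi2 = 1 := by simp [pi2]

lemma re_pi2' : re pi2' = 3 := by simp [pi2']

lemma im_pi2' : im pi2' = -1 := by simp [pi2']

lemma pi2_dvd_iff {x : O17} : pi2 ∣ x ↔ Even (re x) := by
  constructor
  · rintro ⟨y, rfl⟩
    rw [re_mul, re_pi2, im_pi2]
    exact ⟨re y + 2 * im y, by ring⟩
  · rintro ⟨k, hk⟩
    refine ⟨((3 * k - 2 * im x : ℤ) : O17) + ((im x - k : ℤ) : O17) * ω, ext_coord ?_ ?_⟩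
    · simp only [re_mul, re_pi2, im_pi2, re_add, im_add, re_intCast, im_intCast, im_mul, re_ω, im_ω]
      linarith
    · simp only [re_mul, re_pi2, im_pi2, re_add, im_add, re_intCast, im_intCast, im_mul, re_ω, im_ω]
      linarith

lemma pi2'_dvd_iff {x : O17} : pi2' ∣ x ↔ Even (re x + im x) := by
  constructor
  · rintro ⟨y, rfl⟩
    rw [re_mul, im_mul, re_pi2', im_pi2']
    exact ⟨re y - im y, by ring⟩
  · rintro ⟨k, hk⟩
    refine ⟨((im x + 2 * k : ℤ) : O17) + ((im x + k : ℤ) : O17) * ω, ext_coord ?_ ?_⟩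
    · simp only [re_mul, re_pi2', im_pi2', re_add, im_add, re_intCast, im_intCast, im_mul, re_ω,
        im_ω]
      linarith
    · simp only [re_mul, re_pi2', im_pi2', re_add, im_add, re_intCast, im_intCast, im_mul, re_ω,
        im_ω]
      linarith

lemma intCast_dvd_iff {n : ℤ} {x : O17} : (n : O17) ∣ x ↔ n ∣ re x ∧ n ∣ im x := by
  constructor
  · rintro ⟨y, rfl⟩
    simp
  · rintro ⟨⟨a, ha⟩, ⟨b, hb⟩⟩
    exact ⟨(a : O17) + b * ω, ext_coord (by simp [ha]) (by simp [hb])⟩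

lemma two_dvd_iff {x : O17} : (2 : O17) ∣ x ↔ Even (re x) ∧ Even (im x) := by
  have := @intCast_dvd_iff 2 x
  rw [Int.cast_ofNat] at this
  rw [this, even_iff_two_dvd, even_iff_two_dvd]

lemma four_dvd_iff {x : O17} : (4 : O17) ∣ x ↔ 4 ∣ re x ∧ 4 ∣ im x := by
  have := @intCast_dvd_iff 4 x
  rwa [Int.cast_ofNat] at this

lemma pi2_ne_zero : pi2 ≠ 0 := by
  intro h
  have := congrArg re h
  simp [re_pi2] at this

lemma pi2'_ne_zero : pi2' ≠ 0 := by
  intro h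
  have := congrArg re h
  simp [re_pi2'] at this

lemma prime_pi2 : Prime pi2 := by
  refine ⟨pi2_ne_zero, ?_, ?_⟩
  · intro h
    have := pi2_dvd_iff.1 (h.dvd : pi2 ∣ 1)
    simp at this
  · intro a b h
    rw [pi2_dvd_iff] at *
    rw [pi2_dvd_iff]
    rw [re_mul] at h
    by_contra hcon
    push Not at hcon
    simp only [Int.not_even_iff_odd] at hcon
    have h1 := hcon.1.mul hcon.2
    have h2 : Even (4 * im a * im b) := ⟨2 * im a * im b, by ring⟩
    exact (Int.not_even_iff_odd.2 (h1.add_even h2)) h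

lemma prime_pi2' : Prime pi2' := by
  refine ⟨pi2'_ne_zero, ?_, ?_⟩
  · intro h
    have := pi2'_dvd_iff.1 (h.dvd : pi2' ∣ 1)
    simp at this
  · intro a b h
    rw [pi2'_dvd_iff] at *
    rw [pi2'_dvd_iff]
    rw [re_mul, im_mul] at h
    by_contra hcon
    push Not at hcon
    simp only [Int.not_even_iff_odd] at hcon
    have h1 := hcon.1.mul hcon.2
    have h2 : Even (4 * im a * im b) := ⟨2 * im a * im b, by ring⟩
    have h3 := h1.add_even h2
    exact (Int.not_even_iff_odd.2 h3) (by convert h using 1; ring)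

lemma totPos_pi2 : TotPos pi2 := by
  rw [totPos_iff, nrm_eq, re_pi2, im_pi2]
  norm_num

lemma totPos_pi2' : TotPos pi2' := by
  rw [totPos_iff, nrm_eq, re_pi2', im_pi2']
  norm_num

lemma prime_three : Prime (3 : O17) := by
  have h3 : ∀ x : O17, (3 : O17) ∣ x ↔ (3 : ℤ) ∣ nrm x := by
    intro x
    have h := @intCast_dvd_iff 3 x
    rw [Int.cast_ofNat] at h
    rw [h, nrm_eq]
    constructor
    · rintro ⟨⟨a, ha⟩, ⟨b, hb⟩⟩
      rw [ha, hb]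
      exact ⟨3 * a ^ 2 + 3 * a * b - 12 * b ^ 2, by ring⟩
    · intro hd
      have key : ∀ a b : ZMod 3, a ^ 2 + a * b - 4 * b ^ 2 = 0 → a = 0 ∧ b = 0 := by decide
      have h0 := (ZMod.intCast_zmod_eq_zero_iff_dvd _ 3).2 hd
      push_cast at h0
      have := key _ _ h0
      exact ⟨(ZMod.intCast_zmod_eq_zero_iff_dvd _ 3).1 this.1,
        (ZMod.intCast_zmod_eq_zero_iff_dvd _ 3).1 this.2⟩
  refine ⟨?_, ?_, ?_⟩
  · intro h
    have := congrArg re h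
    simp at this
  · intro h
    have := (h3 1).1 h.dvd
    rw [map_one] at this
    norm_num at this
  · intro a b h
    rw [h3, map_mul] at h
    rw [h3, h3]
    exact Int.prime_three.dvd_or_dvd h

/-- If `π` has residue field `𝔽₂` and exactly divides `2`, then a sum of two squares divisible by
`π ^ 2` has both `x` and `y` divisible by `π`. -/
lemma dvd_of_sq_dvd_sum {π π' x y : O17} (hπ : Prime π) (h2 : π * π' = 2) (hπ' : ¬ π ∣ π')
    (hres : ∀ z, π ∣ z ∨ π ∣ z - 1) (h : π ^ 2 ∣ x ^ 2 + y ^ 2) : π ∣ x ∧ π ∣ y := by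
  have h1 : π ∣ x ^ 2 + y ^ 2 := (dvd_pow_self π two_ne_zero).trans h
  rcases hres x with hx | hx
  · exact ⟨hx, hπ.dvd_of_dvd_pow ((dvd_add_right (dvd_pow hx two_ne_zero)).1 h1)⟩
  · rcases hres y with hy | hy
    · exact ⟨hπ.dvd_of_dvd_pow ((dvd_add_left (dvd_pow hy two_ne_zero)).1 h1), hy⟩
    · exfalso
      obtain ⟨a, ha⟩ := hx
      obtain ⟨b, hb⟩ := hy
      obtain ⟨c, hc⟩ := h
      apply hπ'
      refine ⟨c - π' * (a + b) - a ^ 2 - b ^ 2, ?_⟩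
      apply mul_left_cancel₀ hπ.ne_zero
      rw [eq_add_of_sub_eq ha, eq_add_of_sub_eq hb] at hc
      linear_combination hc + (1 + π * (a + b)) * h2

lemma pi2_dvd_of_sum {x y : O17} (h : pi2 ^ 2 ∣ x ^ 2 + y ^ 2) : pi2 ∣ x ∧ pi2 ∣ y := by
  refine dvd_of_sq_dvd_sum prime_pi2 pi2_mul_pi2' ?_ ?_ h
  · rw [pi2_dvd_iff, re_pi2']
    decide
  · intro z
    rw [pi2_dvd_iff, pi2_dvd_iff, re_sub, re_one]
    rcases Int.even_or_odd (re z) with h | h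
    · exact .inl h
    · exact .inr (h.sub_odd odd_one)

lemma pi2'_dvd_of_sum {x y : O17} (h : pi2' ^ 2 ∣ x ^ 2 + y ^ 2) : pi2' ∣ x ∧ pi2' ∣ y := by
  refine dvd_of_sq_dvd_sum prime_pi2' ((mul_comm _ _).trans pi2_mul_pi2') ?_ ?_ h
  · rw [pi2'_dvd_iff, re_pi2, im_pi2]
    decide
  · intro z
    rw [pi2'_dvd_iff, pi2'_dvd_iff, re_sub, im_sub, re_one, im_one]
    rcases Int.even_or_odd (re z + im z) with h | h
    · exact .inl h
    · refine .inr ?_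
      rw [show re z - 1 + (im z - 0) = re z + im z - 1 by ring]
      exact h.sub_odd odd_one

lemma r2_eq (ν : O17) : r2 ν = (reps ν).ncard := rfl

lemma r2_ne_zero_iff {ν : O17} : r2 ν ≠ 0 ↔ ∃ x y : O17, x ^ 2 + y ^ 2 = ν := by
  rw [r2_eq, Ne, Set.ncard_eq_zero (reps_finite ν), ← Ne, ← Set.nonempty_iff_ne_empty]
  exact ⟨fun ⟨t, ht⟩ => ⟨t.1, t.2, ht⟩, fun ⟨x, y, h⟩ => ⟨(x, y), h⟩⟩

/-- Multiplication by `d` is a bijection onto the representations divisible by `d`. -/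
lemma ncard_reps_divisible {d : O17} (hd : d ≠ 0) (ν : O17) :
    {t | t ∈ reps (d ^ 2 * ν) ∧ d ∣ t.1 ∧ d ∣ t.2}.ncard = r2 ν := by
  rw [r2_eq]
  symm
  apply Set.ncard_congr (fun t _ => (d * t.1, d * t.2))
  · rintro ⟨x, y⟩ h
    refine ⟨?_, dvd_mul_right _ _, dvd_mul_right _ _⟩
    change x ^ 2 + y ^ 2 = ν at h
    change (d * x) ^ 2 + (d * y) ^ 2 = d ^ 2 * ν
    rw [← h]
    ring
  · rintro ⟨x, y⟩ ⟨x', y'⟩ _ _ h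
    simpa [hd] using h
  · rintro ⟨x, y⟩ ⟨h, ⟨a, ha⟩, ⟨b, hb⟩⟩
    change x = d * a at ha
    change y = d * b at hb
    change x ^ 2 + y ^ 2 = _ at h
    refine ⟨(a, b), ?_, by rw [ha, hb]⟩
    change a ^ 2 + b ^ 2 = ν
    apply mul_left_cancel₀ (pow_ne_zero 2 hd)
    rw [← h, ha, hb]
    ring

lemma r2_sq_mul {d : O17} (hd : d ≠ 0) (ν : O17)
    (h : ∀ x y, x ^ 2 + y ^ 2 = d ^ 2 * ν → d ∣ x ∧ d ∣ y) : r2 (d ^ 2 * ν) = r2 ν := by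
  rw [← ncard_reps_divisible hd ν, r2_eq]
  congr 1
  ext t
  exact ⟨fun ht => ⟨ht, h _ _ ht⟩, fun ht => ht.1⟩

lemma r2_unit_sq_mul {w : O17} (hw : IsUnit w) (ν : O17) : r2 (w ^ 2 * ν) = r2 ν :=
  r2_sq_mul hw.ne_zero ν fun _ _ _ => ⟨hw.dvd, hw.dvd⟩

lemma r2_pi2_sq_mul (ν : O17) : r2 (pi2 ^ 2 * ν) = r2 ν :=
  r2_sq_mul pi2_ne_zero ν fun _ _ h => pi2_dvd_of_sum ⟨ν, h⟩

lemma r2_pi2'_sq_mul (ν : O17) : r2 (pi2' ^ 2 * ν) = r2 ν :=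
  r2_sq_mul pi2'_ne_zero ν fun _ _ h => pi2'_dvd_of_sum ⟨ν, h⟩

lemma r2_two_mul (ν : O17) : r2 (2 * ν) = r2 ν := by
  rw [r2_eq, r2_eq]
  symm
  have h20 : (2 : O17) ≠ 0 := by
    rw [← pi2_mul_pi2']
    exact mul_ne_zero pi2_ne_zero pi2'_ne_zero
  apply Set.ncard_congr (fun t _ => (t.1 + t.2, t.1 - t.2))
  · rintro ⟨x, y⟩ h
    change x ^ 2 + y ^ 2 = ν at h
    change (x + y) ^ 2 + (x - y) ^ 2 = 2 * ν
    rw [← h]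
    ring
  · rintro ⟨x, y⟩ ⟨x', y'⟩ _ _ h
    simp only [Prod.mk.injEq] at h ⊢
    constructor
    · exact mul_left_cancel₀ h20 (by linear_combination h.1 + h.2)
    · exact mul_left_cancel₀ h20 (by linear_combination h.1 - h.2)
  · rintro ⟨x, y⟩ h
    change x ^ 2 + y ^ 2 = 2 * ν at h
    have hd : (2 : O17) ∣ (x - y) ^ 2 := ⟨ν - x * y, by linear_combination h⟩
    have h1 := pi2_dvd_iff.1 (prime_pi2.dvd_of_dvd_pow ((Dvd.intro _ pi2_mul_pi2').trans hd))
    have h2 := pi2'_dvd_iff.1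
      (prime_pi2'.dvd_of_dvd_pow ((Dvd.intro_left _ pi2_mul_pi2').trans hd))
    obtain ⟨c, hc⟩ := two_dvd_iff.2 ⟨h1, (Int.even_add.1 h2).1 h1⟩
    refine ⟨(y + c, c), ?_, ?_⟩
    · change (y + c) ^ 2 + c ^ 2 = ν
      apply mul_left_cancel₀ h20
      rw [← h, eq_add_of_sub_eq hc]
      ring
    · simp only [Prod.mk.injEq]
      constructor
      · linear_combination -hc
      · ring

lemma r2_pi2'_mul (ν : O17) : r2 (pi2' * ν) = r2 (pi2 * ν) := by
  rw [← r2_two_mul (pi2' * ν), ← pi2_mul_pi2',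
    show pi2 * pi2' * (pi2' * ν) = pi2' ^ 2 * (pi2 * ν) by ring, r2_pi2'_sq_mul]

lemma sum_sq_mod_four {x y ν : O17} (h : x ^ 2 + y ^ 2 = ν) (hre : Odd (re ν))
    (him : Even (im ν)) : (4 : O17) ∣ ν - 1 := by
  have key : ∀ a b c d : ZMod 4,
      (2 * (a ^ 2 + 4 * b ^ 2 + c ^ 2 + 4 * d ^ 2) = 2 ∧
        2 * (2 * a * b + b ^ 2 + 2 * c * d + d ^ 2) = 0) →
      (a ^ 2 + 4 * b ^ 2 + c ^ 2 + 4 * d ^ 2 - 1 = 0 ∧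
        2 * a * b + b ^ 2 + 2 * c * d + d ^ 2 = 0) := by decide
  have hr : re ν = re x ^ 2 + 4 * im x ^ 2 + re y ^ 2 + 4 * im y ^ 2 := by
    rw [← h, re_add, sq x, sq y, re_mul, re_mul]
    ring
  have hi : im ν = 2 * re x * im x + im x ^ 2 + 2 * re y * im y + im y ^ 2 := by
    rw [← h, im_add, sq x, sq y, im_mul, im_mul]
    ring
  have hkey := key (re x : ZMod 4) (im x : ZMod 4) (re y : ZMod 4) (im y : ZMod 4)
  obtain ⟨k, hk⟩ := hre
  obtain ⟨l, hl⟩ := him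
  have h4 : (4 : ZMod 4) = 0 := by decide
  have h1 := congrArg (Int.cast : ℤ → ZMod 4) (hr.symm.trans hk)
  have h2 := congrArg (Int.cast : ℤ → ZMod 4) (hi.symm.trans hl)
  push_cast at h1 h2
  obtain ⟨h5, h6⟩ := hkey ⟨by rw [h1]; linear_combination (k : ZMod 4) * h4,
    by rw [h2]; linear_combination (l : ZMod 4) * h4⟩
  rw [four_dvd_iff, re_sub, im_sub, re_one, im_one]
  constructor
  · refine (ZMod.intCast_zmod_eq_zero_iff_dvd _ 4).1 ?_
    rw [hr]
    push_cast
    exact h5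
  · refine (ZMod.intCast_zmod_eq_zero_iff_dvd _ 4).1 ?_
    rw [hi]
    push_cast
    linear_combination h6

lemma not_sum_sq_pi2_mul {x y μ : O17} (hμ : (4 : O17) ∣ μ - 1) : x ^ 2 + y ^ 2 ≠ pi2 * μ := by
  intro h
  have key : ∀ a b c d : ZMod 4, ¬ (a ^ 2 + 4 * b ^ 2 + c ^ 2 + 4 * d ^ 2 = 2 ∧
        2 * a * b + b ^ 2 + 2 * c * d + d ^ 2 = 1) := by decide
  obtain ⟨hr, hi⟩ := four_dvd_iff.1 (hμ.mul_left pi2)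
  rw [mul_sub, mul_one, ← h] at hr hi
  apply key (re x : ZMod 4) (im x : ZMod 4) (re y : ZMod 4) (im y : ZMod 4)
  have hr' := (ZMod.intCast_zmod_eq_zero_iff_dvd _ 4).2 hr
  have hi' := (ZMod.intCast_zmod_eq_zero_iff_dvd _ 4).2 hi
  simp only [sq, re_sub, im_sub, re_add, im_add, re_mul, im_mul, re_pi2, im_pi2] at hr' hi'
  push_cast at hr' hi'
  exact ⟨by linear_combination hr', by linear_combination hi'⟩

lemma odd_re_of_odd_nrm {x : O17} (h : Odd (nrm x)) : Odd (re x) := by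
  have h1 := even_im_of_odd_nrm h
  rw [nrm_eq] at h
  by_contra hcon
  rw [Int.not_odd_iff_even] at hcon
  obtain ⟨k, hk⟩ := hcon
  refine Int.not_odd_iff_even.2 ?_ h
  rw [hk]
  exact ⟨2 * k ^ 2 + k * im x - 2 * im x ^ 2, by ring⟩

lemma four_dvd_sq_sub_one {w : O17} (hw : Odd (nrm w)) : (4 : O17) ∣ w ^ 2 - 1 := by
  obtain ⟨k, hk⟩ := odd_re_of_odd_nrm hw
  obtain ⟨l, hl⟩ := even_im_of_odd_nrm hw
  rw [four_dvd_iff]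
  simp only [sq, re_sub, im_sub, re_mul, im_mul, re_one, im_one, hk, hl]
  exact ⟨⟨k ^ 2 + k + 4 * l ^ 2, by ring⟩, ⟨(2 * k + 1) * l + l ^ 2, by ring⟩⟩

lemma odd_nrm_of_isUnit {w : O17} (hw : IsUnit w) : Odd (nrm w) := by
  have h := Int.natAbs_eq_iff.1 (Int.isUnit_iff_natAbs_eq.1 (hw.map nrm))
  rcases h with h | h <;> rw [h] <;> decide

lemma four_dvd_sub_of_span_eq {μ μ' : O17} (hμ : TotPos μ) (hμ' : TotPos μ')
    (h : Ideal.span {μ} = Ideal.span {μ'}) : (4 : O17) ∣ μ - μ' := by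
  obtain ⟨u, hu⟩ := Ideal.span_singleton_eq_span_singleton.1 h
  have hup : TotPos (u : O17) := TotPos.of_mul_left hμ (hu ▸ hμ')
  obtain ⟨w, hw, hwu⟩ := exists_sq_of_totPos_unit u.isUnit hup
  obtain ⟨c, hc⟩ := four_dvd_sq_sub_one (odd_nrm_of_isUnit hw)
  refine ⟨-μ * c, ?_⟩
  rw [← hu, hwu]
  linear_combination -μ * hc

lemma exists_sum_of_sq_mul {d ν : O17} (hd : d ≠ 0)
    (hdiv : ∀ x y, d ^ 2 ∣ x ^ 2 + y ^ 2 → d ∣ x ∧ d ∣ y)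
    (h : ∃ x y : O17, x ^ 2 + y ^ 2 = d ^ 2 * ν) : ∃ x y : O17, x ^ 2 + y ^ 2 = ν := by
  rw [← r2_ne_zero_iff] at h ⊢
  rwa [r2_sq_mul hd ν fun x y hxy => hdiv x y ⟨ν, hxy⟩] at h

/-- Division in the Brahmagupta identity. -/
lemma exists_sum_div {p d n : O17} (hp : Prime p) (hd : ∃ a b : O17, a ^ 2 + b ^ 2 = d * p)
    (hn : ∃ x y : O17, x ^ 2 + y ^ 2 = p * n) : ∃ x y : O17, x ^ 2 + y ^ 2 = d * n := by
  obtain ⟨a, b, hab⟩ := hd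
  obtain ⟨x, y, hxy⟩ := hn
  have main : ∀ b, a ^ 2 + b ^ 2 = d * p → p ∣ a * x - b * y →
      ∃ x y : O17, x ^ 2 + y ^ 2 = d * n := by
    intro b hab hdvd
    have hsum : (a * x - b * y) ^ 2 + (b * x + a * y) ^ 2 = p ^ 2 * (d * n) := by
      linear_combination (x ^ 2 + y ^ 2) * hab + d * p * hxy
    have h2 : p ∣ (b * x + a * y) := by
      apply hp.dvd_of_dvd_pow (n := 2)
      apply (dvd_add_right (dvd_pow hdvd two_ne_zero)).1
      rw [hsum, sq p, mul_assoc]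
      exact dvd_mul_right _ _
    obtain ⟨X, hX⟩ := hdvd
    obtain ⟨Y, hY⟩ := h2
    refine ⟨X, Y, mul_left_cancel₀ (pow_ne_zero 2 hp.ne_zero) ?_⟩
    rw [← hsum, hX, hY]
    ring
  have hprod : p ∣ (a * x - b * y) * (a * x - -b * y) :=
    ⟨a ^ 2 * n - y ^ 2 * d, by linear_combination a ^ 2 * hxy - y ^ 2 * hab⟩
  rcases hp.dvd_or_dvd hprod with h | h
  · exact main b hab h
  · exact main (-b) (by rw [neg_sq, hab]) h

lemma exists_sum_of_prime {μ : O17} (hμ : TotPos μ) (hp : Prime μ)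
    (hn : (nrm μ).natAbs % 4 ≠ 3) :
    (∃ x y : O17, x ^ 2 + y ^ 2 = μ) ∨ ∃ x y : O17, x ^ 2 + y ^ 2 = pi2 * μ := by
  obtain ⟨t, ht⟩ := (exists_dvd_sq_add_one_iff hp).2 hn
  obtain ⟨x, y, c, hxy, hc⟩ := exists_small_multiple hμ ht
  have swap : ∀ ν : O17, (∃ x y : O17, x ^ 2 + y ^ 2 = pi2' * ν) →
      ∃ x y : O17, x ^ 2 + y ^ 2 = pi2 * ν := by
    intro ν
    rw [← r2_ne_zero_iff, ← r2_ne_zero_iff, r2_pi2'_mul]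
    exact id
  have unit : ∀ w v ν : O17, w * v = 1 → (∃ x y : O17, x ^ 2 + y ^ 2 = w ^ 2 * ν) →
      ∃ x y : O17, x ^ 2 + y ^ 2 = ν := by
    intro w v ν hw
    rw [← r2_ne_zero_iff, ← r2_ne_zero_iff, r2_unit_sq_mul (IsUnit.of_mul_eq_one v hw)]
    exact id
  rcases hc with rfl | rfl | rfl | rfl | rfl | rfl | rfl
  · left
    exact ⟨x, y, by rw [hxy, one_mul]⟩
  · left
    rw [← r2_ne_zero_iff, ← r2_two_mul, r2_ne_zero_iff]
    exact ⟨x, y, hxy⟩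
  · right
    refine exists_sum_div prime_three ⟨1 + ω, 1, ?_⟩ ⟨x, y, hxy⟩
    unfold pi2
    linear_combination ω_sq
  · right
    exact ⟨x, y, hxy⟩
  · right
    exact swap μ ⟨x, y, hxy⟩
  · right
    apply swap
    apply unit (3 + 2 * ω) (2 * ω - 5) _ (by linear_combination 4 * ω_sq)
    apply exists_sum_of_sq_mul pi2'_ne_zero fun x y => pi2'_dvd_of_sum
    refine ⟨x, y, hxy.trans ?_⟩
    have : (3 + ω : O17) = pi2' ^ 3 * (3 + 2 * ω) ^ 2 := ext_coord
      (by simp [pow_succ, pi2']) (by simp [pow_succ, pi2'])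
    rw [this]
    ring
  · right
    apply unit (5 - 2 * ω) (-(3 + 2 * ω)) _ (by linear_combination 4 * ω_sq)
    apply exists_sum_of_sq_mul pi2_ne_zero fun x y => pi2_dvd_of_sum
    refine ⟨x, y, hxy.trans ?_⟩
    have : (4 - ω : O17) = pi2 ^ 3 * (5 - 2 * ω) ^ 2 := ext_coord
      (by simp [pow_succ, pi2]) (by simp [pow_succ, pi2])
    rw [this]
    ring

lemma exists_sum_of_prime_one {μ : O17} (hμ : TotPos μ) (hp : Prime μ)
    (hn : (nrm μ).natAbs % 4 ≠ 3) (h1 : (4 : O17) ∣ μ - 1) : ∃ x y : O17, x ^ 2 + y ^ 2 = μ := by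
  refine (exists_sum_of_prime hμ hp hn).resolve_right ?_
  rintro ⟨x, y, h⟩
  exact not_sum_sq_pi2_mul h1 h

lemma exists_sum_of_prime_three {μ : O17} (hμ : TotPos μ) (hp : Prime μ)
    (hn : (nrm μ).natAbs % 4 ≠ 3) (h3 : (4 : O17) ∣ μ - 3) :
    ∃ x y : O17, x ^ 2 + y ^ 2 = pi2 * μ := by
  refine (exists_sum_of_prime hμ hp hn).resolve_left ?_
  rintro ⟨x, y, h⟩
  have hc := four_dvd_iff.1 h3
  simp only [re_sub, im_sub, re_ofNat, im_ofNat] at hc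
  have h1 := four_dvd_iff.1 (sum_sq_mod_four h (by rw [Int.odd_iff]; omega)
    (by rw [Int.even_iff]; omega))
  simp only [re_sub, im_sub, re_one, im_one] at h1
  omega

/-- The number of representations of `ν` as a sum of two squares both divisible by `μ`. -/
def divReps (μ ν : O17) : ℕ :=
  {t | t ∈ reps ν ∧ μ ∣ t.1 ∧ μ ∣ t.2}.ncard

lemma divReps_sq_mul {μ : O17} (hμ : μ ≠ 0) (ν : O17) : divReps μ (μ ^ 2 * ν) = r2 ν :=
  ncard_reps_divisible hμ ν

lemma divReps_eq_zero {μ ν : O17} (h : ¬ μ ^ 2 ∣ ν) : divReps μ ν = 0 := by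
  unfold divReps
  convert Set.ncard_empty (O17 × O17)
  rw [Set.eq_empty_iff_forall_notMem]
  rintro ⟨x, y⟩ ⟨hxy, ⟨a, ha⟩, ⟨b, hb⟩⟩
  change x = μ * a at ha
  change y = μ * b at hb
  change x ^ 2 + y ^ 2 = ν at hxy
  apply h
  refine ⟨a ^ 2 + b ^ 2, ?_⟩
  rw [← hxy, ha, hb]
  ring

lemma ncard_image_rotation {a b s : O17} (hs : s ≠ 0) (hab : a ^ 2 + b ^ 2 = s) (τ : O17) :
    ((fun t : O17 × O17 => (a * t.1 - b * t.2, b * t.1 + a * t.2)) '' reps τ).ncard = r2 τ := by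
  rw [r2_eq]
  apply Set.ncard_image_of_injective
  rintro ⟨x, y⟩ ⟨x', y'⟩ h
  simp only [Prod.mk.injEq] at h ⊢
  constructor
  · apply mul_left_cancel₀ hs
    rw [← hab]
    linear_combination a * h.1 + b * h.2
  · apply mul_left_cancel₀ hs
    rw [← hab]
    linear_combination a * h.2 - b * h.1

lemma mem_image_rotation {a b s : O17} (hs : s ≠ 0) (hab : a ^ 2 + b ^ 2 = s) (τ : O17)
    (t : O17 × O17) :
    t ∈ (fun t : O17 × O17 => (a * t.1 - b * t.2, b * t.1 + a * t.2)) '' reps τ ↔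
      t ∈ reps (s * τ) ∧ s ∣ a * t.1 + b * t.2 ∧ s ∣ a * t.2 - b * t.1 := by
  obtain ⟨X, Y⟩ := t
  constructor
  · rintro ⟨⟨x, y⟩, h, hxy⟩
    change x ^ 2 + y ^ 2 = τ at h
    simp only [Prod.mk.injEq] at hxy
    refine ⟨?_, ⟨x, ?_⟩, ⟨y, ?_⟩⟩
    · change X ^ 2 + Y ^ 2 = s * τ
      rw [← hxy.1, ← hxy.2, ← h, ← hab]
      ring
    · change a * X + b * Y = s * x
      rw [← hxy.1, ← hxy.2, ← hab]
      ring
    · change a * Y - b * X = s * y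
      rw [← hxy.1, ← hxy.2, ← hab]
      ring
  · rintro ⟨h, ⟨x, hx⟩, ⟨y, hy⟩⟩
    change X ^ 2 + Y ^ 2 = s * τ at h
    change a * X + b * Y = s * x at hx
    change a * Y - b * X = s * y at hy
    refine ⟨(x, y), ?_, ?_⟩
    · change x ^ 2 + y ^ 2 = τ
      apply mul_left_cancel₀ (pow_ne_zero 2 hs)
      rw [show s ^ 2 * (x ^ 2 + y ^ 2) = (s * x) ^ 2 + (s * y) ^ 2 by ring, ← hx, ← hy]
      linear_combination (a ^ 2 + b ^ 2) * h + s * τ * hab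
    · simp only [Prod.mk.injEq]
      constructor
      · apply mul_left_cancel₀ hs
        linear_combination -a * hx + b * hy + X * hab
      · apply mul_left_cancel₀ hs
        linear_combination -b * hx - a * hy + Y * hab

/-- The representations of `s * τ` split, with overlap, into the two rotations of those of `τ`. -/
lemma r2_mul_add_divReps {a b d μ τ : O17} (hp : Prime μ) (hab : a ^ 2 + b ^ 2 = d * μ)
    (h2 : ¬ μ ∣ 2) (hμd : ¬ μ ∣ d)
    (hd : ∀ x y, x ^ 2 + y ^ 2 = d * μ * τ → d ∣ x ∧ d ∣ y) :
    r2 (d * μ * τ) + divReps μ (d * μ * τ) = 2 * r2 τ := by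
  have hd0 : d ≠ 0 := fun h => hμd (h ▸ dvd_zero μ)
  have hs : d * μ ≠ 0 := mul_ne_zero hd0 hp.ne_zero
  have hab' : a ^ 2 + (-b) ^ 2 = d * μ := by rw [neg_sq, hab]
  have hcop : ∀ x, d ∣ x → μ ∣ x → d * μ ∣ x := by
    rintro x ⟨z, rfl⟩ hz
    exact mul_dvd_mul_left d ((hp.dvd_or_dvd hz).resolve_left hμd)
  set S₁ := (fun t : O17 × O17 => (a * t.1 - b * t.2, b * t.1 + a * t.2)) '' reps τ with hS₁
  set S₂ := (fun t : O17 × O17 => (a * t.1 - -b * t.2, -b * t.1 + a * t.2)) '' reps τ with hS₂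
  have hm₁ : ∀ t, t ∈ S₁ ↔ _ := mem_image_rotation hs hab τ
  have hm₂ : ∀ t, t ∈ S₂ ↔ _ := mem_image_rotation hs hab' τ
  have half : ∀ b X Y : O17, a ^ 2 + b ^ 2 = d * μ → X ^ 2 + Y ^ 2 = d * μ * τ →
      μ ∣ a * X + b * Y → d * μ ∣ a * X + b * Y ∧ d * μ ∣ a * Y - b * X := by
    intro b X Y hab h hdvd
    obtain ⟨hX, hY⟩ := hd X Y h
    refine ⟨hcop _ (dvd_add (hX.mul_left _) (hY.mul_left _)) hdvd,
      hcop _ (dvd_sub (hY.mul_left _) (hX.mul_left _)) ?_⟩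
    apply hp.dvd_of_dvd_pow (n := 2)
    apply (dvd_add_right (dvd_pow hdvd two_ne_zero)).1
    exact ⟨d ^ 2 * μ * τ, by linear_combination (a ^ 2 + b ^ 2) * h + d * μ * τ * hab⟩
  have hunion : S₁ ∪ S₂ = reps (d * μ * τ) := by
    ext ⟨X, Y⟩
    rw [Set.mem_union, hm₁, hm₂]
    constructor
    · rintro (h | h)
      · exact h.1
      · exact h.1
    · intro h
      change X ^ 2 + Y ^ 2 = d * μ * τ at h
      have hprod : μ ∣ (a * X + b * Y) * (a * X + -b * Y) :=
        ⟨a ^ 2 * (d * τ) - Y ^ 2 * d, by linear_combination a ^ 2 * h - Y ^ 2 * hab⟩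
      rcases hp.dvd_or_dvd hprod with h' | h'
      · exact .inl ⟨h, half b X Y hab h h'⟩
      · exact .inr ⟨h, half (-b) X Y hab' h h'⟩
  have hinter : S₁ ∩ S₂ = {t | t ∈ reps (d * μ * τ) ∧ μ ∣ t.1 ∧ μ ∣ t.2} := by
    ext ⟨X, Y⟩
    rw [Set.mem_inter_iff, hm₁, hm₂]
    constructor
    · rintro ⟨⟨h, h1, h1'⟩, ⟨-, h2', h2''⟩⟩
      have hmul : ∀ z, d * μ ∣ z → μ ∣ z := fun z hz => (dvd_mul_left μ d).trans hz
      have e1 : μ ∣ 2 * (a * X) := by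
        have := dvd_add (hmul _ h1) (hmul _ h2')
        convert this using 1
        ring
      have e2 : μ ∣ 2 * (b * Y) := by
        have := dvd_sub (hmul _ h1) (hmul _ h2')
        convert this using 1
        ring
      have e3 : μ ∣ 2 * (a * Y) := by
        have := dvd_add (hmul _ h1') (hmul _ h2'')
        convert this using 1
        ring
      have e4 : μ ∣ 2 * (b * X) := by
        have := dvd_sub (hmul _ h2'') (hmul _ h1')
        convert this using 1
        ring
      have can : ∀ z, μ ∣ 2 * z → μ ∣ z := fun z hz => (hp.dvd_or_dvd hz).resolve_left h2
      refine ⟨h, ?_⟩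
      by_cases ha : μ ∣ a
      · by_cases hb : μ ∣ b
        · exfalso
          obtain ⟨u, rfl⟩ := ha
          obtain ⟨v, rfl⟩ := hb
          apply hμd
          refine ⟨u ^ 2 + v ^ 2, mul_right_cancel₀ hp.ne_zero ?_⟩
          rw [← hab]
          ring
        · exact ⟨(hp.dvd_or_dvd (can _ e4)).resolve_left hb,
            (hp.dvd_or_dvd (can _ e2)).resolve_left hb⟩
      · exact ⟨(hp.dvd_or_dvd (can _ e1)).resolve_left ha,
          (hp.dvd_or_dvd (can _ e3)).resolve_left ha⟩
    · rintro ⟨h, hX, hY⟩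
      exact ⟨⟨h, half b X Y hab h (dvd_add (hX.mul_left _) (hY.mul_left _))⟩,
        ⟨h, half (-b) X Y hab' h (dvd_add (hX.mul_left _) (hY.mul_left _))⟩⟩
  have hfin₁ : S₁.Finite := (reps_finite τ).image _
  have hfin₂ : S₂.Finite := (reps_finite τ).image _
  have key := Set.ncard_union_add_ncard_inter S₁ S₂ hfin₁ hfin₂
  rw [hunion, hinter, ncard_image_rotation hs hab τ, ncard_image_rotation hs hab' τ] at key
  rw [r2_eq, divReps, key, two_mul]

/-- Primes that are themselves sums of two squares. -/
lemma r2_split_pow_mul {μ ν : O17} (hp : Prime μ) (h2 : ¬ μ ∣ 2)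
    (hsum : ∃ a b : O17, a ^ 2 + b ^ 2 = μ) (hν : ¬ μ ∣ ν) (n : ℕ) :
    r2 (μ ^ n * ν) = (n + 1) * r2 ν := by
  obtain ⟨a, b, hab⟩ := hsum
  have hrec : ∀ τ, r2 (μ * τ) + divReps μ (μ * τ) = 2 * r2 τ := by
    intro τ
    have := r2_mul_add_divReps (τ := τ) (d := 1) hp (by rw [hab, one_mul]) h2
      (fun h => hp.not_isUnit (isUnit_of_dvd_one h)) (fun x y _ => ⟨one_dvd x, one_dvd y⟩)
    rwa [one_mul] at this
  induction n using Nat.twoStepInduction with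
  | zero => simp
  | one =>
    have h1 := hrec ν
    rw [divReps_eq_zero] at h1
    · rw [pow_one]
      omega
    · intro h
      rw [sq μ] at h
      exact hν ((mul_dvd_mul_iff_left hp.ne_zero).1 h)
  | more n ih ih' =>
    have h1 := hrec (μ ^ (n + 1) * ν)
    rw [show μ * (μ ^ (n + 1) * ν) = μ ^ 2 * (μ ^ n * ν) by ring, divReps_sq_mul hp.ne_zero,
      ih, ih'] at h1
    rw [show μ ^ (n + 2) * ν = μ ^ 2 * (μ ^ n * ν) by ring]
    nlinarith

/-- Primes that become sums of two squares after multiplication by `pi2`. -/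
lemma r2_twisted_pow_mul {μ : O17} (hp : Prime μ) (h2 : ¬ μ ∣ 2)
    (hsum : ∃ a b : O17, a ^ 2 + b ^ 2 = pi2 * μ) (n : ℕ) :
    ∀ ν : O17, ¬ μ ∣ ν → r2 (μ ^ n * ν) = (n + 1) * r2 (pi2 ^ n * ν) := by
  obtain ⟨a, b, hab⟩ := hsum
  have hμ2 : ¬ μ ∣ pi2 := fun h => h2 (h.trans (Dvd.intro _ pi2_mul_pi2'))
  have hrec : ∀ τ, r2 (μ * τ) + divReps μ (pi2 ^ 2 * (μ * τ)) = 2 * r2 (pi2 * τ) := by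
    intro τ
    have := r2_mul_add_divReps (τ := pi2 * τ) (d := pi2) hp hab h2 hμ2
      (fun x y h => pi2_dvd_of_sum ⟨μ * τ, by rw [h]; ring⟩)
    rwa [show pi2 * μ * (pi2 * τ) = pi2 ^ 2 * (μ * τ) by ring, r2_pi2_sq_mul] at this
  induction n using Nat.twoStepInduction with
  | zero => simp
  | one =>
    intro ν hν
    have h1 := hrec ν
    rw [divReps_eq_zero] at h1
    · rw [pow_one, pow_one]
      omega
    · intro h
      rw [sq μ, show pi2 ^ 2 * (μ * ν) = μ * (pi2 ^ 2 * ν) by ring] at h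
      rcases hp.dvd_or_dvd ((mul_dvd_mul_iff_left hp.ne_zero).1 h) with h | h
      · exact hμ2 (hp.dvd_of_dvd_pow h)
      · exact hν h
  | more n ih ih' =>
    intro ν hν
    have h1 := hrec (μ ^ (n + 1) * ν)
    have h3 := ih' (pi2 * ν) fun h => (hp.dvd_or_dvd h).elim hμ2 hν
    rw [show pi2 ^ 2 * (μ * (μ ^ (n + 1) * ν)) = μ ^ 2 * (pi2 ^ 2 * (μ ^ n * ν)) by ring,
      divReps_sq_mul hp.ne_zero, r2_pi2_sq_mul, ih ν hν,
      show pi2 * (μ ^ (n + 1) * ν) = μ ^ (n + 1) * (pi2 * ν) by ring, h3,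
      show pi2 ^ (n + 1) * (pi2 * ν) = pi2 ^ 2 * (pi2 ^ n * ν) by ring, r2_pi2_sq_mul,
      show μ * (μ ^ (n + 1) * ν) = μ ^ (n + 2) * ν by ring] at h1
    rw [show pi2 ^ (n + 2) * ν = pi2 ^ 2 * (pi2 ^ n * ν) by ring, r2_pi2_sq_mul]
    nlinarith

lemma dvd_of_dvd_sum_sq {μ : O17} (hp : Prime μ) (hno : ¬ ∃ t, μ ∣ t ^ 2 + 1) {x y : O17}
    (h : μ ∣ x ^ 2 + y ^ 2) : μ ∣ x ∧ μ ∣ y := by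
  have hx : μ ∣ x := by
    by_contra hx
    obtain ⟨u, v, huv⟩ := (hp.irreducible.coprime_iff_not_dvd).2 hx
    obtain ⟨c, hc⟩ := h
    apply hno
    refine ⟨v * y, u * (1 + v * x) + v ^ 2 * c, ?_⟩
    linear_combination v ^ 2 * hc - (1 + v * x) * huv
  exact ⟨hx, hp.dvd_of_dvd_pow ((dvd_add_right (dvd_pow hx two_ne_zero)).1 h)⟩

/-- Primes modulo which `-1` is not a square. -/
lemma r2_inert_pow_mul {μ ν : O17} (hp : Prime μ) (hno : ¬ ∃ t, μ ∣ t ^ 2 + 1) (hν : ¬ μ ∣ ν)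
    (n : ℕ) : r2 (μ ^ n * ν) = if Even n then r2 ν else 0 := by
  induction n using Nat.twoStepInduction with
  | zero => simp
  | one =>
    rw [pow_one, if_neg (by decide)]
    by_contra h
    obtain ⟨x, y, hxy⟩ := r2_ne_zero_iff.1 h
    obtain ⟨⟨a, ha⟩, ⟨b, hb⟩⟩ := dvd_of_dvd_sum_sq hp hno ⟨ν, hxy⟩
    apply hν
    refine ⟨a ^ 2 + b ^ 2, mul_left_cancel₀ hp.ne_zero ?_⟩
    rw [← hxy, ha, hb]
    ring
  | more n ih ih' =>
    rw [show μ ^ (n + 2) * ν = μ ^ 2 * (μ ^ n * ν) by ring,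
      r2_sq_mul hp.ne_zero _ fun x y h => dvd_of_dvd_sum_sq hp hno
        ⟨μ * (μ ^ n * ν), by rw [h]; ring⟩, ih]
    simp only [Nat.even_add, even_two, iff_true]

lemma r2_pi2'_pow_mul (n : ℕ) (ν : O17) : r2 (pi2' ^ n * ν) = r2 (pi2 ^ n * ν) := by
  induction n generalizing ν with
  | zero => simp
  | succ n ih =>
    rw [pow_succ pi2', mul_assoc, ih, show pi2 ^ n * (pi2' * ν) = pi2' * (pi2 ^ n * ν) by ring,
      r2_pi2'_mul]
    congr 1
    ring

lemma r2_one : r2 1 = 4 := by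
  have h : reps 1 = {(1, 0), (-1, 0), (0, 1), (0, -1)} := by
    ext ⟨x, y⟩
    simp only [Set.mem_insert_iff, Set.mem_singleton_iff, Prod.mk.injEq]
    constructor
    · intro h
      change x ^ 2 + y ^ 2 = 1 at h
      have hr := congrArg re h
      have hi := congrArg im h
      simp only [sq, re_add, im_add, re_mul, im_mul, re_one, im_one] at hr hi
      have htr : re x ^ 2 + (re x + im x) ^ 2 + 8 * im x ^ 2 + re y ^ 2 + (re y + im y) ^ 2 +
        8 * im y ^ 2 = 2 := by linear_combination 2 * hr + hi
      have hx : im x = 0 := by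
        by_contra hne
        have : 0 < im x ^ 2 := by positivity
        nlinarith [sq_nonneg (re x), sq_nonneg (re x + im x), sq_nonneg (re y),
          sq_nonneg (re y + im y), sq_nonneg (im y)]
      have hy : im y = 0 := by
        by_contra hne
        have : 0 < im y ^ 2 := by positivity
        nlinarith [sq_nonneg (re x), sq_nonneg (re x + im x), sq_nonneg (re y),
          sq_nonneg (re y + im y), sq_nonneg (im x)]
      rw [hx, hy] at hr
      have b1 : re x ≤ 1 := by nlinarith [sq_nonneg (re y)]
      have b2 : -1 ≤ re x := by nlinarith [sq_nonneg (re y)]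
      have b3 : re y ≤ 1 := by nlinarith [sq_nonneg (re x)]
      have b4 : -1 ≤ re y := by nlinarith [sq_nonneg (re x)]
      have ex : ∀ {z : O17} {k : ℤ}, im z = 0 → re z = k → z = k := fun h h' =>
        ext_coord (by simp [h']) (by simp [h])
      have hcases : (re x = 1 ∧ re y = 0) ∨ (re x = -1 ∧ re y = 0) ∨ (re x = 0 ∧ re y = 1) ∨
          (re x = 0 ∧ re y = -1) := by
        generalize re x = r at *
        generalize re y = s at *
        interval_cases r <;> interval_cases s <;> omega
      rcases hcases with ⟨h, h'⟩ | ⟨h, h'⟩ | ⟨h, h'⟩ | ⟨h, h'⟩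
      · exact .inl ⟨by simpa using ex hx h, by simpa using ex hy h'⟩
      · exact .inr (.inl ⟨by simpa using ex hx h, by simpa using ex hy h'⟩)
      · exact .inr (.inr (.inl ⟨by simpa using ex hx h, by simpa using ex hy h'⟩))
      · exact .inr (.inr (.inr ⟨by simpa using ex hx h, by simpa using ex hy h'⟩))
    · rintro (⟨rfl, rfl⟩ | ⟨rfl, rfl⟩ | ⟨rfl, rfl⟩ | ⟨rfl, rfl⟩)
      · change (1 : O17) ^ 2 + 0 ^ 2 = 1
        ring
      · change (-1 : O17) ^ 2 + 0 ^ 2 = 1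
        ring
      · change (0 : O17) ^ 2 + 1 ^ 2 = 1
        ring
      · change (0 : O17) ^ 2 + (-1) ^ 2 = 1
        ring
  have hne : (1 : O17) ≠ -1 := by
    intro h
    have := congrArg re h
    simp at this
  have hne' : (-1 : O17) ≠ 0 := by simp
  rw [r2_eq, h, Set.ncard_insert_of_notMem, Set.ncard_insert_of_notMem, Set.ncard_pair]
  · simp [hne]
  · simp
  · simp [hne]

lemma r2_pi2_pow_unit {w : O17} (hw : IsUnit w) (k : ℕ) :
    r2 (pi2 ^ k * w ^ 2) = if Even k then 4 else 0 := by
  rw [mul_comm, r2_unit_sq_mul hw]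
  induction k using Nat.twoStepInduction with
  | zero => simp [r2_one]
  | one =>
    rw [if_neg (by decide)]
    by_contra h
    obtain ⟨x, y, hxy⟩ := r2_ne_zero_iff.1 h
    exact not_sum_sq_pi2_mul (μ := 1) (by simp) (by rw [hxy]; ring)
  | more n ih ih' =>
    rw [show pi2 ^ (n + 2) = pi2 ^ 2 * pi2 ^ n by ring, r2_pi2_sq_mul, ih]
    simp only [Nat.even_add, even_two, iff_true]

lemma isPrime_span {μ : O17} (hp : Prime μ) : (Ideal.span {μ}).IsPrime :=
  (Ideal.span_singleton_prime hp.ne_zero).2 hp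

lemma span_ne_bot {μ : O17} (hμ : μ ≠ 0) : Ideal.span {μ} ≠ ⊥ := by
  rwa [Ne, Ideal.span_singleton_eq_bot]

/-- Any two totally positive generators are congruent modulo four. -/
lemma exists_totPos_generator_iff {μ c : O17} (hμ : TotPos μ) :
    (∃ μ' : O17, Ideal.span {μ} = Ideal.span {μ'} ∧ TotPos μ' ∧ (4 : O17) ∣ μ' - c) ↔
      (4 : O17) ∣ μ - c := by
  constructor
  · rintro ⟨μ', h, hμ', h4⟩
    have := dvd_add (four_dvd_sub_of_span_eq hμ hμ' h) h4
    rwa [sub_add_sub_cancel] at this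
  · exact fun h => ⟨μ, rfl, hμ, h⟩

lemma typeP_span_iff {μ : O17} (hp : Prime μ) (hμ : TotPos μ) :
    typeP (Ideal.span {μ}) ↔ (4 : O17) ∣ μ - 1 := by
  rw [typeP, exists_totPos_generator_iff hμ]
  exact ⟨fun h => h.2.2, fun h => ⟨isPrime_span hp, span_ne_bot hp.ne_zero, h⟩⟩

lemma typeQ_span_iff {μ : O17} (hp : Prime μ) (hμ : TotPos μ) :
    typeQ (Ideal.span {μ}) ↔ (4 : O17) ∣ μ - 3 := by
  rw [typeQ, exists_totPos_generator_iff hμ]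
  exact ⟨fun h => h.2.2, fun h => ⟨isPrime_span hp, span_ne_bot hp.ne_zero, h⟩⟩

lemma typeR_span_iff {μ : O17} (hp : Prime μ) (hμ : TotPos μ) :
    typeR (Ideal.span {μ}) ↔ (4 : O17) ∣ μ - (2 * ω - 1) ∨ (4 : O17) ∣ μ - (2 * ω + 1) := by
  rw [← exists_totPos_generator_iff hμ, ← exists_totPos_generator_iff hμ, ← exists_or]
  simp only [typeR, ← and_or_left]
  exact ⟨fun h => h.2.2, fun h => ⟨isPrime_span hp, span_ne_bot hp.ne_zero, h⟩⟩

lemma exists_totPos_span {P : Ideal O17} (hP : P.IsPrime) (hP0 : P ≠ ⊥) :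
    ∃ μ, Prime μ ∧ TotPos μ ∧ P = Ideal.span {μ} := by
  obtain ⟨π, hπ⟩ := (IsPrincipalIdealRing.principal P).principal
  have hπ' : P = Ideal.span {π} := hπ
  have hπ0 : π ≠ 0 := by
    rintro rfl
    apply hP0
    rw [hπ', Ideal.span_singleton_eq_bot]
  obtain ⟨u, hu, hup⟩ := exists_totPos_associate hπ0
  have hass : Ideal.span {u * π} = P := by
    rw [hπ', Ideal.span_singleton_eq_span_singleton]
    exact associated_unit_mul_left π u hu
  refine ⟨u * π, ?_, hup, hass.symm⟩
  rw [← Ideal.span_singleton_prime hup.ne_zero, hass]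
  exact hP

lemma span_pow_dvd_iff {π ν : O17} {m : ℕ} :
    Ideal.span {π} ^ m ∣ Ideal.span {ν} ↔ π ^ m ∣ ν := by
  rw [Ideal.span_singleton_pow, Ideal.dvd_span_singleton, Ideal.mem_span_singleton]

/-- A prime totally positive divisor, normalized above two. -/
lemma exists_prime_dvd {ν : O17} (hν : TotPos ν) (hu : ¬ IsUnit ν) :
    ∃ μ, Prime μ ∧ TotPos μ ∧ μ ∣ ν ∧ (μ = pi2 ∨ μ = pi2' ∨ Odd (nrm μ)) := by
  obtain ⟨π, hπ, hdvd⟩ := WfDvdMonoid.exists_irreducible_factor hu hν.ne_zero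
  have hπ' : Prime π := hπ.prime
  obtain ⟨u, hu, hup⟩ := exists_totPos_associate hπ'.ne_zero
  have hass : Associated (u * π) π := associated_unit_mul_left π u hu
  rcases Int.even_or_odd (nrm (u * π)) with h | h
  · have hcase : pi2 ∣ u * π ∨ pi2' ∣ u * π := by
      rw [pi2_dvd_iff, pi2'_dvd_iff]
      rw [nrm_eq] at h
      have h1 : Even (re (u * π) * (re (u * π) + im (u * π))) := by
        have h2 : Even (4 * im (u * π) ^ 2) := ⟨2 * im (u * π) ^ 2, by ring⟩
        have h3 := h.add h2
        rwa [show ∀ a b : ℤ, a ^ 2 + a * b - 4 * b ^ 2 + 4 * b ^ 2 = a * (a + b) by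
          intros; ring] at h3
      exact Int.even_mul.1 h1
    rcases hcase with h' | h'
    · refine ⟨pi2, prime_pi2, totPos_pi2, ?_, .inl rfl⟩
      exact (h'.trans hass.dvd).trans hdvd
    · refine ⟨pi2', prime_pi2', totPos_pi2', ?_, .inr (.inl rfl)⟩
      exact (h'.trans hass.dvd).trans hdvd
  · exact ⟨u * π, hass.symm.prime hπ', hup, hass.dvd.trans hdvd, .inr (.inr h)⟩

@[to_additive]
lemma finprod_mem_update_one {ι M : Type*} [CommMonoid M] [DecidableEq ι] (S : Set ι)
    [DecidablePred (· ∈ S)] (g : ι → M) (i : ι)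
    (hfin : (S ∩ Function.mulSupport (Function.update g i 1)).Finite) :
    ∏ᶠ j ∈ S, g j = (if i ∈ S then g i else 1) * ∏ᶠ j ∈ S, Function.update g i 1 j := by
  split_ifs with hi
  · have hS : S = insert i (S \ {i}) := by
      rw [Set.insert_sdiff_singleton, Set.insert_eq_of_mem hi]
    have hsub : ∏ᶠ j ∈ S \ {i}, g j = ∏ᶠ j ∈ S, Function.update g i 1 j := by
      rw [← finprod_mem_inter_mulSupport (s := S)]
      rw [← finprod_mem_inter_mulSupport (s := S \ {i})]
      apply finprod_mem_congr
      · ext j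
        by_cases hj : j = i <;> simp [hj]
      · rintro j ⟨-, hj⟩
        rw [Function.update_of_ne]
        rintro rfl
        simp at hj
    rw [← hsub]
    conv_lhs => rw [hS]
    apply finprod_mem_insert' _ (by simp)
    apply hfin.subset
    rintro j ⟨⟨hj, hji⟩, hj'⟩
    refine ⟨hj, ?_⟩
    rw [Function.mem_mulSupport, Function.update_of_ne hji]
    exact hj'
  · rw [one_mul]
    apply finprod_mem_congr rfl
    intro j hj
    rw [Function.update_of_ne]
    rintro rfl
    exact hi hj

/-- `f` records the exponents of the nonzero primes in the ideal generated by `ν`. -/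
def HasExponents (ν : O17) (f : Ideal O17 → ℕ) : Prop :=
  ∀ P : Ideal O17, P.IsPrime → P ≠ ⊥ →
    P ^ f P ∣ Ideal.span {ν} ∧ ¬ P ^ (f P + 1) ∣ Ideal.span {ν}

/-- The exponent whose parity decides representability. -/
def repExponent (f : Ideal O17 → ℕ) : ℕ :=
  f (Ideal.span {pi2}) + f (Ideal.span {pi2'}) + ∑ᶠ Q ∈ {Q : Ideal O17 | typeQ Q}, f Q

/-- The expected number of representations when there are any. -/
def repProduct (f : Ideal O17 → ℕ) : ℤ :=
  4 * (∏ᶠ P ∈ {P : Ideal O17 | typeP P}, (1 + f P : ℤ)) *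
    ∏ᶠ Q ∈ {Q : Ideal O17 | typeQ Q}, (1 + f Q : ℤ)

/-- Representability of `pi2 ^ k` times an element with exponents `f`. -/
def RepCondition (f : Ideal O17 → ℕ) (k : ℕ) : Prop :=
  Even (repExponent f + k) ∧ ∀ R : Ideal O17, typeR R → Even (f R)

lemma HasExponents.eq_zero_of_isUnit {ν : O17} {f : Ideal O17 → ℕ} (hf : HasExponents ν f)
    (hν : IsUnit ν) {P : Ideal O17} (hP : P.IsPrime) (hP0 : P ≠ ⊥) : f P = 0 := by
  by_contra h
  have h1 := (dvd_pow_self P h).trans (hf P hP hP0).1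
  rw [Ideal.span_singleton_eq_top.2 hν, ← Ideal.one_eq_top] at h1
  exact hP.ne_top (Ideal.isUnit_iff.1 (isUnit_of_dvd_one h1))

lemma HasExponents.apply_span {μ ν : O17} {n : ℕ} {f : Ideal O17 → ℕ}
    (hf : HasExponents (μ ^ n * ν) f) (hp : Prime μ) (hν : ¬ μ ∣ ν) :
    f (Ideal.span {μ}) = n := by
  obtain ⟨h1, h2⟩ := hf _ (isPrime_span hp) (span_ne_bot hp.ne_zero)
  rw [span_pow_dvd_iff] at h1 h2
  apply le_antisymm
  · by_contra! hlt
    have h3 := (pow_dvd_pow μ hlt).trans h1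
    rw [pow_succ μ, mul_dvd_mul_iff_left (pow_ne_zero n hp.ne_zero)] at h3
    exact hν h3
  · by_contra! hlt
    exact h2 ((pow_dvd_pow μ hlt).trans (dvd_mul_right _ _))

open scoped Classical in
lemma HasExponents.update {μ ν : O17} {n : ℕ} {f : Ideal O17 → ℕ}
    (hf : HasExponents (μ ^ n * ν) f) (hp : Prime μ) (hν : ¬ μ ∣ ν) :
    HasExponents ν (Function.update f (Ideal.span {μ}) 0) := by
  intro P hP hP0
  by_cases h : P = Ideal.span {μ}
  · subst h
    rw [Function.update_self, pow_zero, zero_add, span_pow_dvd_iff, pow_one]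
    exact ⟨one_dvd _, hν⟩
  · rw [Function.update_of_ne h]
    obtain ⟨h1, h2⟩ := hf P hP hP0
    obtain ⟨π, hπ, -, rfl⟩ := exists_totPos_span hP hP0
    rw [span_pow_dvd_iff] at h1 h2 ⊢
    rw [span_pow_dvd_iff]
    refine ⟨hπ.pow_dvd_of_dvd_mul_left _ ?_ h1, fun h3 => h2 (h3.mul_left _)⟩
    intro h3
    apply h
    rw [Ideal.span_singleton_eq_span_singleton]
    exact hπ.associated_of_dvd hp (hπ.dvd_of_dvd_pow h3)

lemma support_update_subset {ι : Type*} [DecidableEq ι] (f : ι → ℕ) (i : ι) :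
    Function.support f ⊆ insert i (Function.support (Function.update f i 0)) := by
  intro j hj
  by_cases h : j = i
  · exact .inl h
  · right
    rwa [Function.mem_support, Function.update_of_ne h]

open scoped Classical in
lemma repExponent_update (f : Ideal O17 → ℕ) (P : Ideal O17)
    (hfin : ({P : Ideal O17 | P.IsPrime ∧ P ≠ ⊥} ∩
      Function.support (Function.update f P 0)).Finite) :
    repExponent f = (if P = Ideal.span {pi2} then f P else 0) +
      (if P = Ideal.span {pi2'} then f P else 0) + (if typeQ P then f P else 0) +
      repExponent (Function.update f P 0) := by
  have h := finsum_mem_update_zero {Q : Ideal O17 | typeQ Q} f P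
    (hfin.subset fun Q hQ => ⟨⟨hQ.1.1, hQ.1.2.1⟩, hQ.2⟩)
  have hval : ∀ Q, f Q = (if P = Q then f P else 0) + Function.update f P 0 Q := by
    intro Q
    by_cases hQ : Q = P
    · subst hQ
      simp
    · rw [Function.update_of_ne hQ, if_neg (Ne.symm hQ), zero_add]
  rw [repExponent, h, hval (Ideal.span {pi2}), hval (Ideal.span {pi2'}), repExponent]
  simp only [Set.mem_ofPred_eq]
  ring

open scoped Classical in
lemma repProduct_update (f : Ideal O17 → ℕ) (P : Ideal O17)
    (hfin : ({P : Ideal O17 | P.IsPrime ∧ P ≠ ⊥} ∩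
      Function.support (Function.update f P 0)).Finite) :
    repProduct f = (if typeP P then (1 + f P : ℤ) else 1) *
      (if typeQ P then (1 + f P : ℤ) else 1) * repProduct (Function.update f P 0) := by
  have hg : Function.update (fun Q => (1 + f Q : ℤ)) P 1 =
      fun Q => (1 + Function.update f P 0 Q : ℤ) := by
    ext Q
    by_cases hQ : Q = P
    · subst hQ
      simp
    · rw [Function.update_of_ne hQ, Function.update_of_ne hQ]
  have hsupp : Function.mulSupport (fun Q => (1 + Function.update f P 0 Q : ℤ)) ⊆
      Function.support (Function.update f P 0) := by
    intro Q hQ h0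
    apply hQ
    simp only [h0]
    simp
  have h1 := finprod_mem_update_one {Q : Ideal O17 | typeP Q} (fun Q => (1 + f Q : ℤ)) P
    (by rw [hg]; exact hfin.subset fun Q hQ => ⟨⟨hQ.1.1, hQ.1.2.1⟩, hsupp hQ.2⟩)
  have h2 := finprod_mem_update_one {Q : Ideal O17 | typeQ Q} (fun Q => (1 + f Q : ℤ)) P
    (by rw [hg]; exact hfin.subset fun Q hQ => ⟨⟨hQ.1.1, hQ.1.2.1⟩, hsupp hQ.2⟩)
  rw [hg] at h1 h2
  rw [repProduct, h1, h2, repProduct]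
  simp only [Set.mem_ofPred_eq]
  ring

open scoped Classical in
lemma forall_typeR_update (f : Ideal O17 → ℕ) (P : Ideal O17) :
    (∀ R : Ideal O17, typeR R → Even (f R)) ↔
      (typeR P → Even (f P)) ∧ ∀ R : Ideal O17, typeR R → Even (Function.update f P 0 R) := by
  constructor
  · intro h
    refine ⟨h P, fun R hR => ?_⟩
    by_cases hRP : R = P
    · subst hRP
      simp
    · rw [Function.update_of_ne hRP]
      exact h R hR
  · rintro ⟨h1, h2⟩ R hR
    by_cases hRP : R = P
    · exact hRP ▸ h1 (hRP ▸ hR)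
    · have := h2 R hR
      rwa [Function.update_of_ne hRP] at this

lemma span_pi2_ne_span_pi2' : Ideal.span {pi2} ≠ Ideal.span {pi2'} := by
  intro h
  have := pi2_dvd_iff.1 (Ideal.span_singleton_eq_span_singleton.1 h).dvd
  rw [re_pi2'] at this
  revert this
  decide

lemma span_ne_span_of_odd {μ : O17} (h : Odd (nrm μ)) :
    Ideal.span {μ} ≠ Ideal.span {pi2} ∧ Ideal.span {μ} ≠ Ideal.span {pi2'} := by
  have h1 := odd_re_of_odd_nrm h
  have h2 := even_im_of_odd_nrm h
  constructor
  · intro h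
    exact Int.not_even_iff_odd.2 h1
      (pi2_dvd_iff.1 (Ideal.span_singleton_eq_span_singleton.1 h.symm).dvd)
  · intro h
    exact Int.not_even_iff_odd.2 (h1.add_even h2)
      (pi2'_dvd_iff.1 (Ideal.span_singleton_eq_span_singleton.1 h.symm).dvd)

lemma not_type_pi2 : ¬ typeP (Ideal.span {pi2}) ∧ ¬ typeQ (Ideal.span {pi2}) ∧
    ¬ typeR (Ideal.span {pi2}) := by
  rw [typeP_span_iff prime_pi2 totPos_pi2, typeQ_span_iff prime_pi2 totPos_pi2,
    typeR_span_iff prime_pi2 totPos_pi2]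
  simp only [four_dvd_iff, re_sub, im_sub, re_pi2, im_pi2, re_one, im_one, re_ofNat, im_ofNat,
    re_add, im_add, re_mul, im_mul, re_ω, im_ω]
  omega

lemma not_type_pi2' : ¬ typeP (Ideal.span {pi2'}) ∧ ¬ typeQ (Ideal.span {pi2'}) ∧
    ¬ typeR (Ideal.span {pi2'}) := by
  rw [typeP_span_iff prime_pi2' totPos_pi2', typeQ_span_iff prime_pi2' totPos_pi2',
    typeR_span_iff prime_pi2' totPos_pi2']
  simp only [four_dvd_iff, re_sub, im_sub, re_pi2', im_pi2', re_one, im_one, re_ofNat, im_ofNat,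
    re_add, im_add, re_mul, im_mul, re_ω, im_ω]
  omega

/-- An odd prime has exactly one type, and the type decides whether `-1` is a square. -/
lemma type_cases {μ : O17} (hp : Prime μ) (hμ : TotPos μ) (hodd : Odd (nrm μ)) :
    (typeP (Ideal.span {μ}) ∧ ¬ typeQ (Ideal.span {μ}) ∧ ¬ typeR (Ideal.span {μ}) ∧
      (∃ a b : O17, a ^ 2 + b ^ 2 = μ)) ∨
    (¬ typeP (Ideal.span {μ}) ∧ typeQ (Ideal.span {μ}) ∧ ¬ typeR (Ideal.span {μ}) ∧
      (∃ a b : O17, a ^ 2 + b ^ 2 = pi2 * μ)) ∨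
    (¬ typeP (Ideal.span {μ}) ∧ ¬ typeQ (Ideal.span {μ}) ∧ typeR (Ideal.span {μ}) ∧
      ¬ ∃ t, μ ∣ t ^ 2 + 1) := by
  have hsum1 := exists_sum_of_prime_one hμ hp
  have hsum3 := exists_sum_of_prime_three hμ hp
  have hpos := hμ.nrm_pos
  obtain ⟨k, hk⟩ := odd_re_of_odd_nrm hodd
  obtain ⟨l, hl⟩ := even_im_of_odd_nrm hodd
  have hn : nrm μ = 1 + 4 * (k ^ 2 + k + k * l - 4 * l ^ 2) + 2 * l := by
    rw [nrm_eq, hk, hl]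
    ring
  generalize k ^ 2 + k + k * l - 4 * l ^ 2 = m at hn
  rw [typeP_span_iff hp hμ, typeQ_span_iff hp hμ, typeR_span_iff hp hμ,
    exists_dvd_sq_add_one_iff hp]
  simp only [four_dvd_iff, re_sub, im_sub, re_one, im_one, re_ofNat, im_ofNat,
    re_add, im_add, re_mul, im_mul, re_ω, im_ω, hk, hl] at hsum1 hsum3 ⊢
  generalize nrm μ = N at *
  rcases Int.even_or_odd' l with ⟨j, hj | hj⟩
  · rcases Int.even_or_odd' k with ⟨i, hi | hi⟩
    · refine .inl ⟨by omega, by omega, by omega, hsum1 (by omega) (by omega)⟩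
    · refine .inr (.inl ⟨by omega, by omega, by omega, hsum3 (by omega) (by omega)⟩)
  · refine .inr (.inr ⟨by omega, by omega, by omega, by omega⟩)

open scoped Classical in
/-- The count for `pi2 ^ k * μ ^ n * ν`, given that for the part `ν` prime to `μ`. -/
lemma count_step {μ ν : O17} {n : ℕ} {f : Ideal O17 → ℕ} (hp : Prime μ) (hμ : TotPos μ)
    (hcase : μ = pi2 ∨ μ = pi2' ∨ Odd (nrm μ)) (hν : ¬ μ ∣ ν) (hn : f (Ideal.span {μ}) = n)
    (hfin : ({P : Ideal O17 | P.IsPrime ∧ P ≠ ⊥} ∩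
      Function.support (Function.update f (Ideal.span {μ}) 0)).Finite)
    (ih : ∀ k, (r2 (pi2 ^ k * ν) : ℤ) =
      if RepCondition (Function.update f (Ideal.span {μ}) 0) k then
        repProduct (Function.update f (Ideal.span {μ}) 0) else 0) (k : ℕ) :
    (r2 (pi2 ^ k * (μ ^ n * ν)) : ℤ) = if RepCondition f k then repProduct f else 0 := by
  have hE := repExponent_update f _ hfin
  have hP := repProduct_update f _ hfin
  have hR := forall_typeR_update f (Ideal.span {μ})
  unfold RepCondition at ih ⊢
  rw [hE, hP, hR, hn]
  generalize repProduct (Function.update f (Ideal.span {μ}) 0) = N at *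
  generalize repExponent (Function.update f (Ideal.span {μ}) 0) = e at *
  generalize (∀ R : Ideal O17, typeR R → Even (Function.update f (Ideal.span {μ}) 0 R)) = C at *
  rcases hcase with rfl | rfl | hodd
  · obtain ⟨h1, h2, h3⟩ := not_type_pi2
    simp only [h1, h2, h3, span_pi2_ne_span_pi2', if_true, if_false, false_imp_iff, true_and,
      one_mul, add_zero]
    rw [← mul_assoc, ← pow_add, ih, show n + e + k = e + (k + n) by ring]
    congr
  · obtain ⟨h1, h2, h3⟩ := not_type_pi2'
    simp only [h1, h2, h3, span_pi2_ne_span_pi2'.symm, if_true, if_false, false_imp_iff, true_and,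
      one_mul, add_zero, zero_add]
    rw [mul_left_comm, r2_pi2'_pow_mul, ← mul_assoc, ← pow_add, ih,
      show n + e + k = e + (n + k) by ring]
    congr
  · obtain ⟨hs1, hs2⟩ := span_ne_span_of_odd hodd
    have hμ2 : ¬ μ ∣ pi2 := by
      intro h
      apply hs1
      rw [Ideal.span_singleton_eq_span_singleton]
      exact hp.associated_of_dvd prime_pi2 h
    have hμ2' : ¬ μ ∣ pi2' := by
      intro h
      apply hs2
      rw [Ideal.span_singleton_eq_span_singleton]
      exact hp.associated_of_dvd prime_pi2' h
    have h2 : ¬ μ ∣ 2 := by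
      rw [← pi2_mul_pi2']
      exact fun h => (hp.dvd_or_dvd h).elim hμ2 hμ2'
    have hνk : ¬ μ ∣ pi2 ^ k * ν := fun h =>
      (hp.dvd_or_dvd h).elim (fun h => hμ2 (hp.dvd_of_dvd_pow h)) hν
    rw [mul_left_comm]
    rcases type_cases hp hμ hodd with ⟨h1, h3, h4, h5⟩ | ⟨h1, h3, h4, h5⟩ | ⟨h1, h3, h4, h5⟩
    · simp only [h1, h3, h4, hs1, hs2, if_true, if_false, false_imp_iff, true_and, mul_one,
        add_zero, zero_add]
      rw [r2_split_pow_mul hp h2 h5 hνk]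
      push_cast
      rw [ih, mul_ite, mul_zero, add_comm (n : ℤ)]
      congr
    · simp only [h1, h3, h4, hs1, hs2, if_true, if_false, false_imp_iff, true_and, one_mul,
        add_zero, zero_add]
      rw [r2_twisted_pow_mul hp h2 h5 n _ hνk, ← mul_assoc (pi2 ^ n), ← pow_add]
      push_cast
      rw [ih, mul_ite, mul_zero, add_comm (n : ℤ), show n + e + k = e + (n + k) by ring]
      congr
    · simp only [h1, h3, h4, hs1, hs2, if_false, true_imp_iff, one_mul,
        add_zero, zero_add]
      rw [r2_inert_pow_mul hp h5 hνk]
      by_cases hne : Even n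
      · simp only [hne, if_true, true_and]
        rw [ih]
        congr
      · simp [hne]

open scoped Classical in
lemma count_of_hasExponents (m : ℕ) : ∀ ν : O17, (nrm ν).natAbs = m → TotPos ν →
    ∀ f, HasExponents ν f →
      ({P : Ideal O17 | P.IsPrime ∧ P ≠ ⊥} ∩ Function.support f).Finite ∧
      ∀ k, (r2 (pi2 ^ k * ν) : ℤ) = if RepCondition f k then repProduct f else 0 := by
  induction m using Nat.strong_induction_on with
  | _ m ih =>
    intro ν hm hν f hf
    by_cases hu : IsUnit ν
    · have h0 : ∀ P : Ideal O17, P.IsPrime → P ≠ ⊥ → f P = 0 := fun P =>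
        hf.eq_zero_of_isUnit hu
      have hsum : ∑ᶠ Q ∈ {Q : Ideal O17 | typeQ Q}, f Q = 0 :=
        finsum_mem_eq_zero_of_forall_eq_zero fun Q hQ => h0 Q hQ.1 hQ.2.1
      have hprodP : ∏ᶠ P ∈ {P : Ideal O17 | typeP P}, (1 + f P : ℤ) = 1 :=
        finprod_mem_eq_one_of_forall_eq_one fun Q hQ => by simp [h0 Q hQ.1 hQ.2.1]
      have hprodQ : ∏ᶠ P ∈ {P : Ideal O17 | typeQ P}, (1 + f P : ℤ) = 1 :=
        finprod_mem_eq_one_of_forall_eq_one fun Q hQ => by simp [h0 Q hQ.1 hQ.2.1]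
      refine ⟨?_, fun k => ?_⟩
      · convert Set.finite_empty
        rw [Set.eq_empty_iff_forall_notMem]
        rintro P ⟨⟨h1, h2⟩, h3⟩
        exact h3 (h0 P h1 h2)
      · obtain ⟨w, hw, rfl⟩ := exists_sq_of_totPos_unit hu hν
        have hC : RepCondition f k ↔ Even k := by
          rw [RepCondition, repExponent, hsum, h0 _ (isPrime_span prime_pi2) (span_ne_bot pi2_ne_zero),
            h0 _ (isPrime_span prime_pi2') (span_ne_bot pi2'_ne_zero)]
          simp only [zero_add, and_iff_left_iff_imp]
          intro _ R hR
          rw [h0 R hR.1 hR.2.1]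
          exact Even.zero
        rw [r2_pi2_pow_unit hw, repProduct, hprodP, hprodQ, if_congr hC rfl rfl]
        split_ifs <;> simp
    · obtain ⟨μ, hp, hμ, hdvd, hcase⟩ := exists_prime_dvd hν hu
      obtain ⟨ν₀, heq, hν₀⟩ := FiniteMultiplicity.exists_eq_pow_mul_and_not_dvd
        (FiniteMultiplicity.of_prime_left hp hν.ne_zero)
      generalize multiplicity μ ν = n at heq
      subst heq
      have hpos := TotPos.of_mul_left (hμ.pow n) hν
      have hn0 : n ≠ 0 := by
        rintro rfl
        rw [pow_zero, one_mul] at hdvd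
        exact hν₀ hdvd
      have hlt : (nrm ν₀).natAbs < m := by
        have hone : 1 < (nrm μ).natAbs := by
          have h1 : (nrm μ).natAbs ≠ 1 := fun h =>
            hp.not_isUnit ((isUnit_iff_nrm μ).2 (Int.isUnit_iff_natAbs_eq.2 h))
          have h2 := hμ.nrm_pos
          omega
        have h0 : 0 < (nrm ν₀).natAbs := Int.natAbs_pos.2 hpos.nrm_pos.ne'
        rw [← hm, map_mul, map_pow, Int.natAbs_mul, Int.natAbs_pow]
        exact lt_mul_of_one_lt_left h0 (Nat.one_lt_pow hn0 hone)
      have hn := hf.apply_span hp hν₀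
      obtain ⟨hfin, hcount⟩ := ih _ hlt ν₀ rfl hpos _ (hf.update hp hν₀)
      refine ⟨?_, count_step hp hμ hcase hν₀ hn hfin hcount⟩
      apply (hfin.insert (Ideal.span {μ})).subset
      rintro P ⟨h1, h2⟩
      exact (support_update_subset f _ h2).imp_right fun h => ⟨h1, h⟩

lemma repProduct_pos (f : Ideal O17 → ℕ) : 0 < repProduct f := by
  have h (S : Set (Ideal O17)) : 0 < ∏ᶠ P ∈ S, (1 + f P : ℤ) :=
    finprod_mem_induction (fun x : ℤ => 0 < x) one_pos (fun _ _ => mul_pos) fun _ _ => by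
      positivity
  exact mul_pos (mul_pos four_pos (h _)) (h _)

/-- Criterion for a totally positive ν ∈ O_K to be a sum of two
squares, and the formula for the number of representations.  Here `f P` is the
exponent v_P((ν)) of the nonzero prime ideal P in (ν), characterized by
P^(f P) ∣ (ν) and ¬ P^(f P + 1) ∣ (ν). -/
theorem two_squares_classification17 (ν : O17) (hpos : TotPos ν)
    (f : Ideal O17 → ℕ)
    (hf : ∀ P : Ideal O17, P.IsPrime → P ≠ ⊥ →
      P ^ f P ∣ Ideal.span {ν} ∧ ¬ P ^ (f P + 1) ∣ Ideal.span {ν}) :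
    ((∃ x y : O17, x ^ 2 + y ^ 2 = ν) ↔
      (Even (f (Ideal.span {pi2}) + f (Ideal.span {pi2'}) +
          ∑ᶠ Q ∈ {Q : Ideal O17 | typeQ Q}, f Q) ∧
       ∀ R : Ideal O17, typeR R → Even (f R))) ∧
    ((Even (f (Ideal.span {pi2}) + f (Ideal.span {pi2'}) +
          ∑ᶠ Q ∈ {Q : Ideal O17 | typeQ Q}, f Q) ∧
       ∀ R : Ideal O17, typeR R → Even (f R)) →
      (r2 ν : ℤ) = 4 * (∏ᶠ P ∈ {P : Ideal O17 | typeP P}, (1 + f P : ℤ)) *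
        ∏ᶠ Q ∈ {Q : Ideal O17 | typeQ Q}, (1 + f Q : ℤ)) := by
  classical
  have hcount : (r2 ν : ℤ) = if RepCondition f 0 then repProduct f else 0 := by
    simpa using (count_of_hasExponents _ ν rfl hpos f hf).2 0
  refine ⟨r2_ne_zero_iff.symm.trans ?_, fun h => hcount.trans (if_pos h)⟩
  change _ ↔ RepCondition f 0
  rw [← Int.natCast_ne_zero, hcount, ite_ne_right_iff]
  exact and_iff_left (repProduct_pos f).ne'

end Paper17
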